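/- arXiv:0711.2684 — 2 statements merged into one kernel-verified Lean document; each statement's English description precedes it below -/
import Mathlib

section
/- For every n ≥ 1, the composition L' ∘ L, applied n times to any Dyck n-path, equals the reversal of that path: (L' ∘ L)^n = R on the set of Dyck n-paths, where R is the involution that reads a Dyck path from right to left, interchanging the roles of upsteps and downsteps. -/
/-- A Dyck path, encoded as a list of steps: `true` = upstep `u`, `false` = downstep `d`. -/
def IsDyck (p : List Bool) : Prop :=
  p.count true = p.count false ∧ ∀ q : List Bool, q <+: p → q.count false ≤ q.count true

/-- A Dyck `n`-path: a Dyck path with `n` upsteps (and `n` downsteps). -/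
def IsDyckN (n : ℕ) (p : List Bool) : Prop := IsDyck p ∧ p.count true = n

/-- The (0-indexed) positions `j` such that step `j` is `a` and step `j+1` is `b`. -/
def adjPositions (a b : Bool) (p : List Bool) : List ℕ :=
  (List.range p.length).filter (fun j => p[j]? == some a && p[j+1]? == some b)

/-- Labels of the first downstep of each occurrence of `dd` (downsteps labelled left to
right by 1, 2, …). -/
def lkA (p : List Bool) : List ℕ :=
  (adjPositions false false p).map (fun j => (p.take (j+1)).count false)

/-- Labels of the first upstep of each occurrence of `uu` (upsteps labelled left to
right by 1, 2, …). -/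
def lkD (p : List Bool) : List ℕ :=
  (adjPositions true true p).map (fun j => (p.take (j+1)).count true)

/-- The Dyck path of size `n` whose partial-sum ascent-descent code is `(A, D)`:
its ascent lengths are the successive differences of `A ++ [n]`, and its descent
lengths are the successive differences of `D ++ [n]`. -/
def pathOfCode (n : ℕ) (A D : List ℕ) : List Bool :=
  let A' := A ++ [n]
  let D' := D ++ [n]
  let a := List.zipWith (· - ·) A' (0 :: A')
  let d := List.zipWith (· - ·) D' (0 :: D')
  (List.zipWith (fun x y => List.replicate x true ++ List.replicate y false) a d).flatten

/-- The Lalanne–Kreweras involution `L` on Dyck paths: the image is the Dyck path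
whose partial-sum ascent-descent code is `(lkA p, lkD p)`. -/
def Lmap (p : List Bool) : List Bool := pathOfCode (p.count true) (lkA p) (lkD p)

/-- The length of the first component of a Dyck path (the first return to ground level). -/
def firstReturn (p : List Bool) : ℕ :=
  match (List.range' 1 p.length).find? (fun j => (p.take j).count true == (p.take j).count false) with
  | some j => j
  | none => p.length

def componentsAux : ℕ → List Bool → List (List Bool)
  | 0, _ => []
  | _, [] => []
  | fuel+1, p =>
      let j := max 1 (firstReturn p)
      p.take j :: componentsAux fuel (p.drop j)

/-- The decomposition of a Dyck path into its components (elevated Dyck paths). -/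
def components (p : List Bool) : List (List Bool) := componentsAux p.length p

/-- The derivative `F'` of a map `F` on Dyck paths: each component `u Q d` is replaced
by `u (F Q) d`. -/
def pathDeriv (F : List Bool → List Bool) (p : List Bool) : List Bool :=
  ((components p).map (fun c => true :: (F ((c.drop 1).dropLast) ++ [false]))).flatten

/-- The "reverse path" involution `R`: read the path right to left, interchanging the
roles of upsteps and downsteps. -/
def Rmap (p : List Bool) : List Bool := (p.map (fun b => !b)).reverse

/-- Height functions of Dyck paths of size `n`, extended by `0` after the last step. -/
structure IsHeight (n : ℕ) (h : ℕ → ℤ) : Prop where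
  zero : h 0 = 0
  tail : ∀ x, 2 * n ≤ x → h x = 0
  nonneg : ∀ x, 0 ≤ h x
  step : ∀ x, x < 2 * n → h (x + 1) = h x + 1 ∨ h (x + 1) = h x - 1

/-- The type of height functions of Dyck paths of size `n`. -/
abbrev DyckHeight (n : ℕ) : Type := {h : ℕ → ℤ // IsHeight n h}

/-- Toggle at height `r`: exchange the peaks and valleys whose two neighbours have height `r`. -/
def toggle (r : ℤ) (h : ℕ → ℤ) : ℕ → ℤ
  | 0 => h 0
  | x + 1 => if h x = r ∧ h (x + 2) = r then 2 * r - h (x + 1) else h (x + 1)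

theorem toggle_succ (r : ℤ) (h : ℕ → ℤ) (x : ℕ) : toggle r h (x + 1) =
    if h x = r ∧ h (x + 2) = r then 2 * r - h (x + 1) else h (x + 1) := rfl

theorem toggle_toggle_apply (r : ℤ) (h : ℕ → ℤ) (x : ℕ) :
    toggle r (toggle r h) x = h x := by
  have key : ∀ y, toggle r h y = r ↔ h y = r := by
    intro y
    rcases y with _ | y
    · rfl
    · rw [toggle_succ]
      split_ifs <;> omega
  rcases x with _ | x
  · rfl
  · have h1 := key x
    have h2 := key (x + 2)
    have h3 := toggle_succ r h x
    rw [toggle_succ r (toggle r h)]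
    split_ifs at * <;> omega

namespace IsHeight

variable {n : ℕ} {h : ℕ → ℤ}

theorem step_of_ne_left (hh : IsHeight n h) {x : ℕ} (hx : h x ≠ 0) :
    h (x + 1) = h x + 1 ∨ h (x + 1) = h x - 1 := by
  refine hh.step x ?_
  by_contra hlt
  exact hx (hh.tail _ (by omega))

theorem emod_two (hh : IsHeight n h) : ∀ x, x ≤ 2 * n → h x % 2 = (x : ℤ) % 2
  | 0, _ => by simp [hh.zero]
  | x + 1, hx => by
    have := hh.emod_two x (by omega)
    have := hh.step x (by omega)
    push_cast
    omega

theorem le_self (hh : IsHeight n h) : ∀ x, h x ≤ x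
  | 0 => by simp [hh.zero]
  | x + 1 => by
    have h1 := hh.le_self x
    by_cases hx : x < 2 * n
    · have := hh.step x hx
      push_cast
      omega
    · rw [hh.tail (x + 1) (by omega)]
      positivity

protected theorem toggle (hh : IsHeight n h) {r : ℤ} (hr : 1 ≤ r) : IsHeight n (toggle r h) where
  zero := hh.zero
  tail x hx := by
    rcases x with _ | x
    · exact hh.zero
    · rw [toggle_succ, hh.tail (x + 2) (by omega), if_neg (by omega), hh.tail (x + 1) hx]
  nonneg x := by
    rcases x with _ | x
    · exact hh.nonneg 0
    · rw [toggle_succ]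
      have := hh.nonneg (x + 1)
      split_ifs with hc
      · have := hh.step_of_ne_left (x := x) (by omega)
        omega
      · exact this
  step x hx := by
    rcases x with _ | x
    · have h1 := hh.step 0 hx
      have h2 := hh.zero
      have h3 : toggle r h 0 = h 0 := rfl
      rw [toggle_succ, h3, if_neg (by omega)]
      exact h1
    · have h1 := hh.step (x + 1) hx
      have h2 := hh.step x (by omega)
      rw [toggle_succ, toggle_succ, show x + 1 + 1 = x + 2 from rfl] at *
      split_ifs <;> omega

end IsHeight

/-- Peaks and valleys between neighbours of height `k + 1` are exchanged by `heightToggle n k`. -/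
def heightToggle (n k : ℕ) : Equiv.Perm (DyckHeight n) :=
  Function.Involutive.toPerm (fun h => ⟨toggle (k + 1) h.1, h.2.toggle (by omega)⟩)
    fun h => Subtype.ext (funext fun x => toggle_toggle_apply (k + 1) h.1 x)

theorem heightToggle_apply_zero {n : ℕ} (k : ℕ) (h : DyckHeight n) :
    (heightToggle n k h).1 0 = h.1 0 := rfl

theorem heightToggle_apply_succ {n : ℕ} (k : ℕ) (h : DyckHeight n) (x : ℕ) :
    (heightToggle n k h).1 (x + 1) = if h.1 x = k + 1 ∧ h.1 (x + 2) = k + 1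
      then 2 * (k + 1) - h.1 (x + 1) else h.1 (x + 1) := rfl

theorem heightToggle_heightToggle {n : ℕ} (k : ℕ) (h : DyckHeight n) :
    heightToggle n k (heightToggle n k h) = h :=
  Subtype.ext (funext fun x => toggle_toggle_apply (k + 1) h.1 x)

theorem heightToggle_apply_eq_iff {n k : ℕ} {r : ℤ} (h : DyckHeight n) (x : ℕ)
    (h1 : r ≠ k) (h2 : r ≠ k + 2) : (heightToggle n k h).1 x = r ↔ h.1 x = r := by
  rcases x with _ | x
  · rfl
  · rw [heightToggle_apply_succ]
    split_ifs with hc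
    · have := h.2.step_of_ne_left (x := x) (by omega)
      omega
    · rfl

theorem heightToggle_comm {n i j : ℕ} (hij : i + 2 ≤ j) :
    Commute (heightToggle n i) (heightToggle n j) := by
  ext h : 1
  refine Subtype.ext (funext fun x => ?_)
  simp only [Equiv.Perm.coe_mul, Function.comp_apply]
  rcases x with _ | x
  · rfl
  · have h1 := heightToggle_apply_eq_iff (k := j) (r := i + 1) h x (by omega) (by omega)
    have h2 := heightToggle_apply_eq_iff (k := j) (r := i + 1) h (x + 2) (by omega) (by omega)
    have h3 := heightToggle_apply_eq_iff (k := i) (r := j + 1) h x (by omega) (by omega)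
    have h4 := heightToggle_apply_eq_iff (k := i) (r := j + 1) h (x + 2) (by omega) (by omega)
    have h5 := heightToggle_apply_succ i h x
    have h6 := heightToggle_apply_succ j h x
    rw [heightToggle_apply_succ i (heightToggle n j h),
      heightToggle_apply_succ j (heightToggle n i h)]
    simp only [h1, h2, h3, h4, h5, h6]
    split_ifs <;> omega

/-- Reversal of a Dyck path, on height functions. -/
def reverseHeight (n : ℕ) : Equiv.Perm (DyckHeight n) :=
  Function.Involutive.toPerm
    (fun h => ⟨fun x => h.1 (2 * n - x), {
      zero := h.2.tail _ (by omega)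
      tail := fun x hx => by rw [Nat.sub_eq_zero_of_le hx, h.2.zero]
      nonneg := fun x => h.2.nonneg _
      step := fun x hx => by
        have h1 := h.2.step (2 * n - (x + 1)) (by omega)
        rw [show 2 * n - (x + 1) + 1 = 2 * n - x by omega] at h1
        omega }⟩)
    fun h => Subtype.ext <| funext fun x => by
      by_cases hx : x ≤ 2 * n
      · change h.1 (2 * n - (2 * n - x)) = h.1 x
        rw [Nat.sub_sub_self hx]
      · change h.1 (2 * n - (2 * n - x)) = h.1 x
        rw [h.2.tail x (by omega), h.2.tail _ (by omega)]

theorem reverseHeight_apply {n : ℕ} (h : DyckHeight n) (x : ℕ) :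
    (reverseHeight n h).1 x = h.1 (2 * n - x) := rfl

theorem heightToggle_comm_reverse (n k : ℕ) :
    Commute (heightToggle n k) (reverseHeight n) := by
  ext h : 1
  refine Subtype.ext (funext fun x => ?_)
  simp only [Equiv.Perm.coe_mul, Function.comp_apply]
  rw [reverseHeight_apply]
  by_cases hx : x < 2 * n
  · obtain ⟨y, hy⟩ : ∃ y, 2 * n - x = y + 1 := ⟨2 * n - x - 1, by omega⟩
    rw [hy, heightToggle_apply_succ]
    rcases x with _ | x
    · rw [heightToggle_apply_zero, reverseHeight_apply, hy, h.2.tail (y + 2) (by omega),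
        if_neg (by omega)]
    · have h1 := reverseHeight_apply h x
      have h2 := reverseHeight_apply h (x + 1)
      have h3 := reverseHeight_apply h (x + 2)
      rw [show 2 * n - x = y + 2 by omega] at h1
      rw [hy] at h2
      rw [show 2 * n - (x + 2) = y by omega] at h3
      rw [heightToggle_apply_succ]
      split_ifs <;> omega
  · rw [(heightToggle n k (reverseHeight n h)).2.tail x (by omega),
      show 2 * n - x = 0 by omega, heightToggle_apply_zero, h.2.zero]

/-- The product `t 0 * t 1 * ⋯ * t (k - 1)`. -/
def coxeterProd {G : Type*} [Group G] (t : ℕ → G) : ℕ → G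
  | 0 => 1
  | k + 1 => coxeterProd t k * t k

/-- The product of the `t i` with `i < k` and `i` of the same parity as `k - 1`. -/
def parityProd {G : Type*} [Group G] (t : ℕ → G) : ℕ → G
  | 0 => 1
  | 1 => t 0
  | k + 2 => parityProd t k * t (k + 1)

theorem parityProd_commute {G : Type*} [Group G] (t : ℕ → G) {z : G} :
    ∀ k, (∀ j < k, Commute (t j) z) → Commute (parityProd t k) z
  | 0, _ => Commute.one_left z
  | 1, hz => hz 0 one_pos
  | k + 2, hz => (parityProd_commute t k fun j hj => hz j (by omega)).mul_left
      (hz (k + 1) (by omega))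

/-- A linear Coxeter-type product is conjugate to the corresponding bipartite product, by an
element generated by all but the last factor. -/
theorem exists_conj_coxeterProd {G : Type*} [Group G] (t : ℕ → G)
    (ht : ∀ i j, i + 2 ≤ j → Commute (t i) (t j)) :
    ∀ k, ∃ g : G, (∀ z, (∀ j < k, Commute (t j) z) → Commute g z) ∧
      g * coxeterProd t (k + 1) = parityProd t k * parityProd t (k + 1) * g
  | 0 => ⟨1, fun z _ => Commute.one_left z, by simp [coxeterProd, parityProd]⟩
  | k + 1 => by
    obtain ⟨g, hg, he⟩ := exists_conj_coxeterProd t ht k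
    refine ⟨(parityProd t k)⁻¹ * g, fun z hz => ?_, ?_⟩
    · exact ((parityProd_commute t k fun j hj => hz j (by omega)).inv_left).mul_left
        (hg z fun j hj => hz j (by omega))
    · have h1 : Commute g (t (k + 1)) := hg _ fun j hj => ht _ _ (by omega)
      have h2 : Commute (parityProd t k) (t (k + 1)) :=
        parityProd_commute t k fun j hj => ht _ _ (by omega)
      rw [coxeterProd, parityProd, mul_assoc, ← mul_assoc g, he, mul_assoc, h1.eq, h2.eq]
      group

theorem heightToggle_apply_trichotomy {n : ℕ} (k : ℕ) (h : DyckHeight n) (x : ℕ) :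
    (heightToggle n k h).1 x = h.1 x ∨
      (h.1 x = k ∨ h.1 x = k + 2) ∧
        ((heightToggle n k h).1 x = k ∨ (heightToggle n k h).1 x = k + 2) := by
  rcases x with _ | x
  · exact Or.inl rfl
  · rw [heightToggle_apply_succ]
    split_ifs with hc
    · have := h.2.step_of_ne_left (x := x) (by omega)
      omega
    · exact Or.inl rfl

theorem parityProd_heightToggle_apply_zero {n : ℕ} (k : ℕ) (h : DyckHeight n) :
    (parityProd (heightToggle n) k h).1 0 = 0 := (parityProd (heightToggle n) k h).2.zero

theorem parityProd_heightToggle_apply_succ {n : ℕ} : ∀ (k : ℕ) (h : DyckHeight n) (x : ℕ),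
    (parityProd (heightToggle n) k h).1 (x + 1) =
      if h.1 x = h.1 (x + 2) ∧ 1 ≤ h.1 x ∧ h.1 x ≤ k ∧ (h.1 x - k) % 2 = 0
      then 2 * h.1 x - h.1 (x + 1) else h.1 (x + 1)
  | 0, h, x => by
    rw [if_neg (by push_cast; omega)]
    rfl
  | 1, h, x => by
    have := heightToggle_apply_succ 0 h x
    rw [parityProd, this]
    push_cast
    split_ifs <;> omega
  | k + 2, h, x => by
    have h1 := heightToggle_apply_trichotomy (k + 1) h x
    have h2 := heightToggle_apply_trichotomy (k + 1) h (x + 2)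
    have h3 := heightToggle_apply_succ (k + 1) h x
    rw [parityProd, Equiv.Perm.mul_apply, parityProd_heightToggle_apply_succ k]
    push_cast at *
    split_ifs at * <;> omega

theorem IsHeight.add_le {n : ℕ} {h : ℕ → ℤ} (hh : IsHeight n h) {x : ℕ} (hx : x ≤ 2 * n) :
    h x + x ≤ 2 * n := by
  have h1 := (reverseHeight n ⟨h, hh⟩).2.le_self (2 * n - x)
  rw [reverseHeight_apply, Nat.sub_sub_self hx] at h1
  change h x ≤ _ at h1
  omega

/-- The product of all toggles of one parity satisfies the tropical frieze relation. -/
theorem parityProd_heightToggle_apply_max {n k : ℕ} (hk : n ≤ k + 1) (h : DyckHeight n) {x : ℕ}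
    (hx : x + 2 ≤ 2 * n) (hp : x % 2 = k % 2) :
    (parityProd (heightToggle n) k h).1 (x + 1) =
      max (h.1 x + h.1 (x + 2)) 2 - h.1 (x + 1) := by
  have h1 := h.2.le_self x
  have h2 := h.2.add_le hx
  have h3 := h.2.step x (by omega)
  have h4 := h.2.step (x + 1) (by omega)
  have h5 := h.2.nonneg x
  have h6 := h.2.nonneg (x + 2)
  have h7 := h.2.emod_two x (by omega)
  rw [parityProd_heightToggle_apply_succ]
  rw [show x + 1 + 1 = x + 2 from rfl] at h4
  push_cast at h2
  have h8 := h.2.nonneg (x + 1)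
  split_ifs <;> omega

theorem parityProd_heightToggle_apply_of_ne {n k : ℕ} (h : DyckHeight n) {x : ℕ}
    (hp : x % 2 ≠ k % 2) :
    (parityProd (heightToggle n) k h).1 (x + 1) = h.1 (x + 1) := by
  rw [parityProd_heightToggle_apply_succ, if_neg]
  rintro ⟨-, h2, -, h4⟩
  by_cases hx : x ≤ 2 * n
  · have h7 := h.2.emod_two x hx
    omega
  · have := h.2.tail x (by omega)
    omega

/-- A valley at position `x + 1` with neighbours of height `r`. -/
def IsValley (r : ℤ) (x : ℕ) (h : ℕ → ℤ) : Prop :=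
  h x = r ∧ h (x + 1) = r - 1 ∧ h (x + 2) = r

/-- A peak at position `x + 1` with neighbours of height `r`. -/
def IsPeak (r : ℤ) (x : ℕ) (h : ℕ → ℤ) : Prop :=
  h x = r ∧ h (x + 1) = r + 1 ∧ h (x + 2) = r

theorem isValley_heightToggle_of_lt {n k : ℕ} {r : ℤ} (hr : r ≤ k) (x : ℕ) {h : DyckHeight n}
    (hv : IsValley r x h.1) : IsValley r x (heightToggle n k h).1 := by
  obtain ⟨h1, h2, h3⟩ := hv
  refine ⟨?_, ?_, ?_⟩
  · rcases x with _ | x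
    · exact h1
    · rw [heightToggle_apply_succ, if_neg, h1]
      rintro ⟨-, hc⟩
      have := hc.symm.trans h2
      omega
  · rw [heightToggle_apply_succ, if_neg (by omega), h2]
  · rw [heightToggle_apply_succ, if_neg (by omega), h3]

theorem isPeak_heightToggle_of_gt {n k : ℕ} {r : ℤ} (hr : k + 2 ≤ r) (x : ℕ) {h : DyckHeight n}
    (hv : IsPeak r x h.1) : IsPeak r x (heightToggle n k h).1 := by
  obtain ⟨h1, h2, h3⟩ := hv
  refine ⟨?_, ?_, ?_⟩
  · rcases x with _ | x
    · exact h1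
    · rw [heightToggle_apply_succ, if_neg, h1]
      rintro ⟨-, hc⟩
      have := hc.symm.trans h2
      omega
  · rw [heightToggle_apply_succ, if_neg (by omega), h2]
  · rw [heightToggle_apply_succ, if_neg (by omega), h3]

theorem isPeak_heightToggle_iff {n k : ℕ} (x : ℕ) {h : DyckHeight n} :
    IsPeak (k + 1) x (heightToggle n k h).1 ↔ IsValley (k + 1) x h.1 := by
  have h1 := heightToggle_apply_eq_iff (k := k) (r := k + 1) h x (by omega) (by omega)
  have h2 := heightToggle_apply_eq_iff (k := k) (r := k + 1) h (x + 2) (by omega) (by omega)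
  have h3 := heightToggle_apply_succ k h x
  unfold IsPeak IsValley
  split_ifs at h3 <;> omega

theorem isValley_heightToggle_iff_of_lt {n k : ℕ} {r : ℤ} (hr : r ≤ k) (x : ℕ)
    {h : DyckHeight n} : IsValley r x (heightToggle n k h).1 ↔ IsValley r x h.1 := by
  refine ⟨fun hv => ?_, isValley_heightToggle_of_lt hr x⟩
  simpa only [heightToggle_heightToggle] using isValley_heightToggle_of_lt hr x hv

theorem isPeak_heightToggle_iff_of_gt {n k : ℕ} {r : ℤ} (hr : k + 2 ≤ r) (x : ℕ)
    {h : DyckHeight n} : IsPeak r x (heightToggle n k h).1 ↔ IsPeak r x h.1 := by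
  refine ⟨fun hv => ?_, isPeak_heightToggle_of_gt hr x⟩
  simpa only [heightToggle_heightToggle] using isPeak_heightToggle_of_gt hr x hv

theorem isPeak_coxeterProd_iff_of_gt {n : ℕ} {r : ℤ} (x : ℕ) : ∀ (k : ℕ) {h : DyckHeight n},
    k + 1 ≤ r → (IsPeak r x (coxeterProd (heightToggle n) k h).1 ↔ IsPeak r x h.1)
  | 0, h, _ => Iff.rfl
  | k + 1, h, hr => by
    push_cast at hr
    rw [coxeterProd, Equiv.Perm.mul_apply, isPeak_coxeterProd_iff_of_gt x k (by omega),
      isPeak_heightToggle_iff_of_gt (by omega)]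

theorem isPeak_coxeterProd_iff {n : ℕ} {r : ℤ} (hr : 1 ≤ r) (x : ℕ) :
    ∀ (k : ℕ) {h : DyckHeight n}, r ≤ k →
      (IsPeak r x (coxeterProd (heightToggle n) k h).1 ↔ IsValley r x h.1)
  | 0, h, hk => by push_cast at hk; omega
  | k + 1, h, hk => by
    push_cast at hk
    rw [coxeterProd, Equiv.Perm.mul_apply]
    rcases (show r ≤ k ∨ r = k + 1 by omega) with hrk | rfl
    · rw [isPeak_coxeterProd_iff hr x k hrk, isValley_heightToggle_iff_of_lt hrk]
    · rw [isPeak_coxeterProd_iff_of_gt x k le_rfl, isPeak_heightToggle_iff]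

theorem IsHeight.le_of_isPeak_imp {n : ℕ} {h₁ h₂ : ℕ → ℤ} (hh₁ : IsHeight n h₁)
    (hh₂ : IsHeight n h₂) (hp : ∀ r x, 1 ≤ r → IsPeak r x h₁ → IsPeak r x h₂) (x : ℕ) :
    h₁ x ≤ h₂ x := by
  suffices H : ∀ (m x : ℕ), 2 * n - h₁ x ≤ m → h₁ x ≤ h₂ x from
    H (2 * n - h₁ x).toNat x (by omega)
  intro m
  induction m with
  | zero =>
    intro x hx
    by_cases h2 : x ≤ 2 * n
    · have h3 := hh₁.add_le h2
      have h4 : x = 0 := by omega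
      subst h4
      rw [hh₁.zero, hh₂.zero]
    · rw [hh₁.tail x (by omega), hh₂.tail x (by omega)]
  | succ m ih =>
    intro x hx
    push_cast at hx
    by_contra! hlt
    by_cases h2 : x < 2 * n
    · rcases x with _ | x
      · rw [hh₁.zero, hh₂.zero] at hlt
        omega
      · have a1 := hh₁.step x (by omega)
        have a2 := hh₁.step (x + 1) h2
        have b1 := hh₂.step x (by omega)
        have b2 := hh₂.step (x + 1) h2
        have c1 := hh₁.emod_two (x + 1) (by omega)
        have c2 := hh₂.emod_two (x + 1) (by omega)
        have d := hh₂.nonneg (x + 1)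
        have i1 := ih x
        have i2 := ih (x + 1 + 1)
        have hpk : IsPeak (h₁ (x + 1) - 1) x h₁ := by
          refine ⟨?_, ?_, ?_⟩
          · omega
          · omega
          · rw [show x + 2 = x + 1 + 1 from rfl]
            omega
        have := (hp _ _ (by omega) hpk).2.1
        omega
    · rw [hh₁.tail x (by omega), hh₂.tail x (by omega)] at hlt
      omega

/-- If the peaks of `h'` of height at least two sit at the valleys of `h`, then `h'` is the image
of `h` under the product of the toggles, performed from top to bottom. -/
theorem eq_coxeterProd_of_isPeak_iff {n : ℕ} (h h' : DyckHeight n)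
    (hp : ∀ (r : ℤ) (x : ℕ), 1 ≤ r → (IsPeak r x h'.1 ↔ IsValley r x h.1)) :
    h' = coxeterProd (heightToggle n) n h := by
  have hle : ∀ (g : DyckHeight n) (r : ℤ) (x : ℕ), 1 ≤ r → g.1 x = r → r ≤ n := by
    intro g r x hr hx
    by_cases h2 : x ≤ 2 * n
    · have h3 := g.2.add_le h2
      have h4 := g.2.le_self x
      omega
    · have := g.2.tail x (by omega)
      omega
  have key : ∀ (r : ℤ) (x : ℕ), 1 ≤ r →
      (IsPeak r x h'.1 ↔ IsPeak r x (coxeterProd (heightToggle n) n h).1) := by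
    intro r x hr
    by_cases hrn : r ≤ n
    · rw [hp r x hr, isPeak_coxeterProd_iff hr x n hrn]
    · exact ⟨fun hk => absurd (hle _ r x hr hk.1) hrn, fun hk => absurd (hle _ r x hr hk.1) hrn⟩
  refine Subtype.ext (funext fun x => le_antisymm ?_ ?_)
  · exact h'.2.le_of_isPeak_imp (Subtype.property _) (fun r x hr => (key r x hr).1) x
  · exact IsHeight.le_of_isPeak_imp (Subtype.property _) h'.2 (fun r x hr => (key r x hr).2) x

/-- A nonnegative integer-valued function on the cycle of length `N`, with unit steps, which
vanishes at the base point: the contour function of a plane tree. -/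
structure IsContour (N : ℕ) (G : ℤ → ℤ) : Prop where
  period : ∀ z, G (z + N) = G z
  nonneg : ∀ z, 0 ≤ G z
  zero : G 0 = 0
  step : ∀ z, G (z + 1) = G z + 1 ∨ G (z + 1) = G z - 1

/-- The minimum of `G` over the integer interval `[a, a + k]`. -/
def runMin (G : ℤ → ℤ) (a : ℤ) : ℕ → ℤ
  | 0 => G a
  | k + 1 => min (runMin G a k) (G (a + (k + 1)))

theorem runMin_succ (G : ℤ → ℤ) (a : ℤ) (k : ℕ) :
    runMin G a (k + 1) = min (runMin G a k) (G (a + (k + 1))) := rfl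

theorem runMin_succ_left (G : ℤ → ℤ) (a : ℤ) : ∀ k : ℕ,
    runMin G a (k + 1) = min (G a) (runMin G (a + 1) k)
  | 0 => by simp [runMin]
  | k + 1 => by
    rw [runMin_succ, runMin_succ_left G a k, runMin_succ, min_assoc]
    congr 3
    push_cast
    ring

theorem runMin_le (G : ℤ → ℤ) (a : ℤ) : ∀ (k : ℕ) (z : ℤ), a ≤ z → z ≤ a + k → runMin G a k ≤ G z
  | 0, z, h1, h2 => by
    obtain rfl : z = a := by push_cast at h2; omega
    exact le_rfl
  | k + 1, z, h1, h2 => by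
    push_cast at h2
    rw [runMin_succ]
    rcases (show z ≤ a + k ∨ z = a + (k + 1) by omega) with h | rfl
    · exact (min_le_left _ _).trans (runMin_le G a k z h1 h)
    · exact min_le_right _ _

/-- The distance in the plane tree with contour function `G` between the vertices visited at
times `a` and `a + k`. -/
def treeDist (N : ℕ) (G : ℤ → ℤ) (a : ℤ) (k : ℕ) : ℤ :=
  G a + G (a + k) - 2 * max (runMin G a k) (runMin G (a + k) (N - k))

namespace IsContour

variable {N : ℕ} {G : ℤ → ℤ}

theorem runMin_nonneg (hG : IsContour N G) (a : ℤ) : ∀ k, 0 ≤ runMin G a k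
  | 0 => hG.nonneg a
  | k + 1 => le_min (hG.runMin_nonneg a k) (hG.nonneg _)

theorem runMin_period (hG : IsContour N G) (a : ℤ) : ∀ k, runMin G (a + N) k = runMin G a k
  | 0 => hG.period a
  | k + 1 => by
    rw [runMin_succ, runMin_succ, hG.runMin_period a k,
      show a + N + (k + 1) = a + (k + 1) + N by ring, hG.period]

theorem treeDist_period (hG : IsContour N G) (a : ℤ) (k : ℕ) :
    treeDist N G (a + N) k = treeDist N G a k := by
  unfold treeDist
  rw [hG.period, hG.runMin_period, show a + N + k = a + k + N by ring, hG.period,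
    hG.runMin_period]

theorem treeDist_symm (hG : IsContour N G) (a : ℤ) {k : ℕ} (hk : k ≤ N) :
    treeDist N G a k = treeDist N G (a + k) (N - k) := by
  unfold treeDist
  rw [Nat.sub_sub_self hk, show a + k + ((N - k : ℕ) : ℤ) = a + N by push_cast [hk]; ring,
    hG.period, hG.runMin_period, max_comm, add_comm (G a)]

theorem eq_zero_of_mul (hG : IsContour N G) (m : ℤ) : G (N * m) = 0 := by
  induction m with
  | zero => simp [hG.zero]
  | succ m ih => rw [mul_add, mul_one, hG.period, ih]
  | pred m ih => rw [← hG.period, ← ih]; congr 1; ring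

theorem runMin_eq_zero_or (hG : IsContour N G) (hN : 0 < N) (a : ℤ) {k l : ℕ}
    (hkl : N ≤ k + l + 2) : runMin G a k = 0 ∨ runMin G (a + k + 1) l = 0 := by
  have h1 := Int.emod_nonneg (-a) (b := N) (by omega)
  have h2 := Int.emod_lt_of_pos (-a) (b := N) (by omega)
  have h3 := Int.emod_add_mul_ediv (-a) N
  set z := a + (-a) % N with hz
  have hz0 : G z = 0 := by
    rw [show z = N * (-((-a) / N)) by rw [hz]; linarith]
    exact hG.eq_zero_of_mul _
  by_cases hk : z ≤ a + k
  · left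
    have := runMin_le G a k z (by omega) hk
    have := hG.runMin_nonneg a k
    omega
  · right
    have := runMin_le G (a + k + 1) l z (by omega) (by omega)
    have := hG.runMin_nonneg (a + k + 1) l
    omega

theorem treeDist_zero (a : ℤ) : treeDist N G a 0 = 0 := by
  have := runMin_le G a N a le_rfl (by omega)
  simp only [treeDist, Nat.cast_zero, add_zero, Nat.sub_zero, runMin]
  omega

theorem treeDist_self (hG : IsContour N G) (a : ℤ) : treeDist N G a N = 0 := by
  rw [hG.treeDist_symm a le_rfl, Nat.sub_self, treeDist_zero]

theorem treeDist_nonneg (hG : IsContour N G) (a : ℤ) {k : ℕ} (hk : k ≤ N) :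
    0 ≤ treeDist N G a k := by
  have h1 := runMin_le G a k a le_rfl (by omega)
  have h2 := runMin_le G a k (a + k) (by omega) le_rfl
  have h3 := runMin_le G (a + k) (N - k) (a + k) le_rfl (by omega)
  have h4 := runMin_le G (a + k) (N - k) (a + N) (by omega) (by omega)
  rw [hG.period] at h4
  unfold treeDist
  omega

theorem treeDist_step_right (hG : IsContour N G) (a : ℤ) {k : ℕ} (hk : k < N) :
    treeDist N G a (k + 1) = treeDist N G a k + 1 ∨
      treeDist N G a (k + 1) = treeDist N G a k - 1 := by
  obtain ⟨l, rfl⟩ : ∃ l, N = k + l + 1 := ⟨N - k - 1, by omega⟩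
  have h1 := runMin_le G a k a le_rfl (by omega)
  have h2 := runMin_le G a k (a + k) (by omega) le_rfl
  have h3 := runMin_le G (a + k + 1) l (a + k + 1) le_rfl (by omega)
  have h4 := runMin_le G (a + k + 1) l (a + (k + l + 1 : ℕ)) (by omega) (by omega)
  rw [hG.period] at h4
  have h5 := hG.runMin_eq_zero_or (by omega) a (k := k) (l := l) (by omega)
  have h6 := hG.step (a + k)
  have h7 := hG.nonneg (a + k)
  have h8 := hG.nonneg (a + k + 1)
  unfold treeDist
  rw [show k + l + 1 - (k + 1) = l by omega, show k + l + 1 - k = l + 1 by omega, runMin_succ,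
    runMin_succ_left G (a + k)]
  push_cast
  rw [← add_assoc]
  omega

theorem treeDist_step_left (hG : IsContour N G) (a : ℤ) {k : ℕ} (hk : k < N) :
    treeDist N G a (k + 1) = treeDist N G (a + 1) k + 1 ∨
      treeDist N G a (k + 1) = treeDist N G (a + 1) k - 1 := by
  have h := hG.treeDist_step_right (a + 1 + k) (k := N - k - 1) (by omega)
  rw [show N - k - 1 + 1 = N - k by omega, ← hG.treeDist_symm (a + 1) hk.le] at h
  have h2 := hG.treeDist_symm a (k := k + 1) (by omega)
  rw [show a + ((k + 1 : ℕ) : ℤ) = a + 1 + k by push_cast; ring,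
    show N - (k + 1) = N - k - 1 by omega] at h2
  omega

/-- The four-point condition for consecutive times `a, a + 1` and `a + k + 1, a + k + 2`. -/
theorem treeDist_frieze (hG : IsContour N G) (a : ℤ) {k : ℕ} (hk : k + 2 ≤ N) :
    treeDist N G (a + 1) (k + 1) = max (treeDist N G (a + 1) k + treeDist N G a (k + 2)) 2
      - treeDist N G a (k + 1) := by
  obtain ⟨l, rfl⟩ : ∃ l, N = k + l + 2 := ⟨N - k - 2, by omega⟩
  have e1 : k + l + 2 - (k + 1) = l + 1 := by omega
  have e2 : k + l + 2 - (k + 2) = l := by omega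
  have e3 : k + l + 2 - k = l + 2 := by omega
  have p := hG.period a
  have p1 := hG.period (a + 1)
  have h1 := runMin_le G (a + 1) k (a + 1) le_rfl (by omega)
  have h2 := runMin_le G (a + 1) k (a + k + 1) (by omega) (by omega)
  have h3 := runMin_le G (a + k + 2) l (a + k + 2) le_rfl (by omega)
  have h4 := runMin_le G (a + k + 2) l (a + (k + l + 2 : ℕ)) (by omega) (by push_cast; omega)
  rw [p] at h4
  have h5 := hG.runMin_eq_zero_or (by omega) (a + 1) (k := k) (l := l) (by omega)
  rw [show a + 1 + k + 1 = a + k + 2 by ring] at h5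
  have h6 := hG.step a
  have h7 := hG.step (a + k + 1)
  rw [show a + k + 1 + 1 = a + k + 2 by ring] at h7
  have n1 := hG.nonneg a
  have n2 := hG.nonneg (a + 1)
  have n3 := hG.nonneg (a + k + 1)
  have n4 := hG.nonneg (a + k + 2)
  have r1 : runMin G (a + 1) (k + 1) = min (runMin G (a + 1) k) (G (a + k + 2)) := by
    rw [runMin_succ]
    congr 2
    ring
  have r2 : runMin G a (k + 1) = min (G a) (runMin G (a + 1) k) := runMin_succ_left _ _ _
  have r3 : runMin G a (k + 2) =
      min (G a) (min (runMin G (a + 1) k) (G (a + k + 2))) := by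
    rw [runMin_succ_left, r1]
  have s1 : runMin G (a + k + 2) (l + 1) = min (runMin G (a + k + 2) l) (G (a + 1)) := by
    rw [runMin_succ, ← p1]
    congr 2
    push_cast
    ring
  have s2 : runMin G (a + k + 1) (l + 1) = min (G (a + k + 1)) (runMin G (a + k + 2) l) := by
    rw [runMin_succ_left]
    congr 2
    ring
  have s3 : runMin G (a + k + 1) (l + 2) =
      min (G (a + k + 1)) (min (runMin G (a + k + 2) l) (G (a + 1))) := by
    rw [runMin_succ_left, show a + k + 1 + 1 = a + k + 2 by ring, s1]
  unfold treeDist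
  rw [e1, e2, e3]
  push_cast
  rw [show a + 1 + (k + 1 : ℤ) = a + k + 2 by ring, show a + 1 + (k : ℤ) = a + k + 1 by ring,
    show a + (k + 2 : ℤ) = a + k + 2 by ring, show a + (k + 1 : ℤ) = a + k + 1 by ring,
    r1, r2, r3, s1, s2, s3]
  omega

end IsContour

/-- The periodic extension of a height function. -/
def DyckHeight.contour {n : ℕ} (g : DyckHeight n) (z : ℤ) : ℤ := g.1 (z % (2 * n : ℕ)).toNat

theorem DyckHeight.isContour {n : ℕ} (hn : 0 < n) (g : DyckHeight n) :
    IsContour (2 * n) (DyckHeight.contour g) where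
  period z := by unfold DyckHeight.contour; rw [Int.add_emod_right]
  nonneg z := g.2.nonneg _
  zero := by simp [DyckHeight.contour, g.2.zero]
  step z := by
    unfold DyckHeight.contour
    have h1 := Int.emod_nonneg z (b := (2 * n : ℕ)) (by omega)
    have h2 := Int.emod_lt_of_pos z (b := (2 * n : ℕ)) (by omega)
    rw [Int.add_emod, Int.emod_eq_of_lt (a := 1) (by omega) (by omega)]
    generalize z % (2 * n : ℕ) = w at h1 h2
    obtain ⟨x, rfl⟩ := Int.eq_ofNat_of_zero_le h1
    have h3 := g.2.step x (by omega)
    by_cases hx : x + 1 < 2 * n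
    · rw [Int.emod_eq_of_lt (by omega) (by omega)]
      exact h3
    · obtain rfl : x = 2 * n - 1 := by omega
      rw [show ((2 * n - 1 : ℕ) : ℤ) + 1 = (2 * n : ℕ) by omega, Int.emod_self, Int.toNat_zero,
        Int.toNat_natCast, g.2.zero]
      rw [show 2 * n - 1 + 1 = 2 * n by omega, g.2.tail _ le_rfl] at h3
      exact h3

theorem DyckHeight.contour_natCast {n : ℕ} (g : DyckHeight n) {x : ℕ} (hx : x < 2 * n) :
    DyckHeight.contour g x = g.1 x := by
  unfold DyckHeight.contour
  rw [Int.emod_eq_of_lt (by omega) (by omega), Int.toNat_natCast]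

/-- The distances along the diagonals of the zigzag triangulation at time `s`. -/
def zigzag {n : ℕ} (hn : 0 < n) (g : DyckHeight n) (s : ℤ) : DyckHeight n :=
  ⟨fun x => if x ≤ 2 * n then treeDist (2 * n) (DyckHeight.contour g) ((s - x) / 2) x else 0, {
    zero := by
      rw [if_pos (by omega)]
      exact IsContour.treeDist_zero _
    tail := fun x hx => by
      split_ifs with h
      · obtain rfl : x = 2 * n := by omega
        exact (DyckHeight.isContour hn g).treeDist_self _
      · rfl
    nonneg := fun x => by
      split_ifs with h
      · exact (DyckHeight.isContour hn g).treeDist_nonneg _ h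
      · exact le_rfl
    step := fun x hx => by
      rw [if_pos (by omega), if_pos (by omega)]
      rcases Int.emod_two_eq_zero_or_one (s - x) with h | h
      · have := (DyckHeight.isContour hn g).treeDist_step_left ((s - (x + 1 : ℕ)) / 2) hx
        rwa [show (s - (x + 1 : ℕ)) / 2 + 1 = (s - x) / 2 by omega] at this
      · have := (DyckHeight.isContour hn g).treeDist_step_right ((s - x) / 2) hx
        rwa [show (s - (x + 1 : ℕ)) / 2 = (s - x) / 2 by omega] }⟩

theorem zigzag_apply {n : ℕ} (hn : 0 < n) (g : DyckHeight n) (s : ℤ) {x : ℕ} (hx : x ≤ 2 * n) :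
    (zigzag hn g s).1 x = treeDist (2 * n) (DyckHeight.contour g) ((s - x) / 2) x :=
  if_pos hx

theorem parityProd_zigzag {n k : ℕ} (hn : 0 < n) (hk : n ≤ k + 1) (g : DyckHeight n) {s : ℤ}
    (hs : (s - k) % 2 = 0) :
    parityProd (heightToggle n) k (zigzag hn g s) = zigzag hn g (s + 1) := by
  refine Subtype.ext (funext fun x => ?_)
  rcases lt_or_ge x (2 * n) with hx | hx
  · rcases x with _ | x
    · rw [(Subtype.property (zigzag hn g (s + 1))).zero, parityProd_heightToggle_apply_zero]
    · by_cases hp : x % 2 = k % 2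
      · rw [parityProd_heightToggle_apply_max hk _ (by omega) hp, zigzag_apply _ _ _ (by omega),
          zigzag_apply _ _ _ (by omega), zigzag_apply _ _ _ (by omega),
          zigzag_apply _ _ _ (by omega)]
        have := (DyckHeight.isContour hn g).treeDist_frieze ((s - x) / 2 - 1) (k := x) (by omega)
        rw [sub_add_cancel] at this
        rw [show (s + 1 - (x + 1 : ℕ)) / 2 = (s - x) / 2 by omega, this,
          show (s - (x + 1 : ℕ)) / 2 = (s - x) / 2 - 1 by omega,
          show (s - (x + 2 : ℕ)) / 2 = (s - x) / 2 - 1 by omega]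
      · rw [parityProd_heightToggle_apply_of_ne _ hp, zigzag_apply _ _ _ (by omega),
          zigzag_apply _ _ _ (by omega),
          show (s + 1 - (x + 1 : ℕ)) / 2 = (s - (x + 1 : ℕ)) / 2 by omega]
  · rw [(Subtype.property (zigzag hn g (s + 1))).tail x hx,
      (Subtype.property (parityProd (heightToggle n) k (zigzag hn g s))).tail x hx]

theorem gyration_pow_zigzag {k : ℕ} (g : DyckHeight (k + 1)) (m : ℕ) :
    ((parityProd (heightToggle (k + 1)) k * parityProd (heightToggle (k + 1)) (k + 1)) ^ m)
      (zigzag k.succ_pos g (k + 1 : ℕ)) = zigzag k.succ_pos g ((k + 1 : ℕ) + 2 * m) := by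
  induction m with
  | zero => simp
  | succ m ih =>
    rw [pow_succ', Equiv.Perm.mul_apply, ih, Equiv.Perm.mul_apply,
      parityProd_zigzag k.succ_pos (by omega) g (by omega),
      parityProd_zigzag k.succ_pos (by omega) g (by omega)]
    congr 1

theorem zigzag_add {n : ℕ} (hn : 0 < n) (g : DyckHeight n) (s : ℤ) :
    zigzag hn g (s + 2 * n) = reverseHeight n (zigzag hn g s) := by
  refine Subtype.ext (funext fun x => ?_)
  rw [reverseHeight_apply]
  rcases le_or_gt x (2 * n) with hx | hx
  · have hc := DyckHeight.isContour hn g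
    rw [zigzag_apply _ _ _ hx, zigzag_apply _ _ _ (by omega), hc.treeDist_symm _ hx,
      ← hc.treeDist_period ((s - (2 * n - x : ℕ)) / 2)]
    congr 1
    omega
  · rw [(Subtype.property (zigzag hn g (s + 2 * n))).tail x hx.le,
      show 2 * n - x = 0 by omega, (Subtype.property (zigzag hn g s)).zero]

theorem treeDist_contour_zero {n : ℕ} (hn : 0 < n) (g : DyckHeight n) {x : ℕ} (hx : x < 2 * n) :
    treeDist (2 * n) (DyckHeight.contour g) 0 x = g.1 x := by
  have hc := DyckHeight.isContour hn g
  have h1 := runMin_le (DyckHeight.contour g) 0 x 0 le_rfl (by omega)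
  have h2 := hc.runMin_nonneg 0 x
  have h3 := runMin_le (DyckHeight.contour g) (0 + x) (2 * n - x) (0 + (2 * n : ℕ))
    (by omega) (by omega)
  have h4 := hc.runMin_nonneg (0 + x) (2 * n - x)
  have h5 := DyckHeight.contour_natCast g hx
  rw [hc.period] at h3
  simp only [treeDist, hc.zero, zero_add] at *
  omega

theorem zigzag_injective {k : ℕ} :
    Function.Injective fun g : DyckHeight (k + 1) => zigzag k.succ_pos g (k + 1 : ℕ) := by
  intro g₁ g₂ he
  have he' : zigzag k.succ_pos g₁ (k + 1 : ℕ) = zigzag k.succ_pos g₂ (k + 1 : ℕ) := he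
  have hev : ∀ m : ℕ, zigzag k.succ_pos g₁ ((k + 1 : ℕ) + 2 * m) =
      zigzag k.succ_pos g₂ ((k + 1 : ℕ) + 2 * m) := fun m => by
    rw [← gyration_pow_zigzag, ← gyration_pow_zigzag, he']
  have hall : ∀ m : ℕ, zigzag k.succ_pos g₁ ((k + 1 : ℕ) + m) =
      zigzag k.succ_pos g₂ ((k + 1 : ℕ) + m) := fun m => by
    rcases Nat.even_or_odd' m with ⟨j, rfl | rfl⟩
    · exact_mod_cast hev j
    · have h1 := parityProd_zigzag (k := k + 1) k.succ_pos (by omega) g₁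
        (s := (k + 1 : ℕ) + 2 * j) (by omega)
      rw [hev j, parityProd_zigzag (k := k + 1) k.succ_pos (by omega) g₂
        (s := (k + 1 : ℕ) + 2 * j) (by omega)] at h1
      push_cast at h1 ⊢
      rw [← add_assoc, h1]
  refine Subtype.ext (funext fun x => ?_)
  rcases lt_or_ge x (2 * (k + 1)) with hx | hx
  · have h1 := congrArg (fun h => h.1 x) (hall (3 * (k + 1) + x))
    rw [zigzag_apply _ _ _ hx.le, zigzag_apply _ _ _ hx.le,
      show (((k + 1 : ℕ) + (3 * (k + 1) + x : ℕ) : ℤ) - x) / 2 = 0 + (2 * (k + 1) : ℕ) by omega,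
      (DyckHeight.isContour k.succ_pos g₁).treeDist_period,
      (DyckHeight.isContour k.succ_pos g₂).treeDist_period,
      treeDist_contour_zero k.succ_pos _ hx, treeDist_contour_zero k.succ_pos _ hx] at h1
    exact h1
  · rw [g₁.2.tail x hx, g₂.2.tail x hx]

instance DyckHeight.finite (n : ℕ) : Finite (DyckHeight n) := by
  refine Finite.of_injective
    (fun (h : DyckHeight n) (i : Fin (2 * n)) => decide (h.1 (i + 1) = h.1 i + 1)) ?_
  intro h₁ h₂ he
  refine Subtype.ext (funext fun x => ?_)
  induction x with
  | zero => rw [h₁.2.zero, h₂.2.zero]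
  | succ x ih =>
    by_cases hx : x < 2 * n
    · have h1 := congrFun he ⟨x, hx⟩
      simp only [decide_eq_decide] at h1
      have h2 := h₁.2.step x hx
      have h3 := h₂.2.step x hx
      omega
    · rw [h₁.2.tail _ (by omega), h₂.2.tail _ (by omega)]

/-- The `n`-th power of the product of all toggles, from top to bottom, is the reversal. -/
theorem coxeterProd_heightToggle_pow {n : ℕ} (hn : 0 < n) :
    coxeterProd (heightToggle n) n ^ n = reverseHeight n := by
  obtain ⟨k, rfl⟩ : ∃ k, n = k + 1 := ⟨n - 1, by omega⟩
  have hgyr : (parityProd (heightToggle (k + 1)) k * parityProd (heightToggle (k + 1)) (k + 1)) ^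
      (k + 1) = reverseHeight (k + 1) := by
    ext h : 1
    obtain ⟨g, rfl⟩ := Finite.surjective_of_injective zigzag_injective h
    dsimp only
    rw [gyration_pow_zigzag, zigzag_add]
  obtain ⟨g, hg, he⟩ := exists_conj_coxeterProd (heightToggle (k + 1))
    (fun i j hij => heightToggle_comm hij) k
  have h1 := hg (reverseHeight (k + 1)) fun j _ => heightToggle_comm_reverse (k + 1) j
  have h2 := (show SemiconjBy g _ _ from he).pow_right (k + 1)
  rw [hgyr] at h2
  exact mul_left_cancel (h2.eq.trans h1.eq.symm)

/-- The number of steps equal to `v` among the first `x` steps of `p`. -/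
def stepCount (v : Bool) (p : List Bool) (x : ℕ) : ℕ := (p.take x).count v

/-- The `i`-th step equal to `v` precedes the `j`-th step different from `v`. -/
def Precedes (v : Bool) (p : List Bool) (i j : ℕ) : Prop := i ≤ stepCount v p (i + j - 1)

section StepCount

variable {v : Bool} {p q : List Bool} {x y : ℕ}

theorem stepCount_zero (v : Bool) (p : List Bool) : stepCount v p 0 = 0 := by
  simp [stepCount]

theorem stepCount_succ (v : Bool) (p : List Bool) (x : ℕ) :
    stepCount v p (x + 1) = stepCount v p x + if p[x]? = some v then 1 else 0 := by
  unfold stepCount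
  rw [List.take_add_one, List.count_append]
  congr 1
  rcases p[x]? with _ | b
  · simp
  · simp [List.count_singleton]

theorem stepCount_of_length_le (h : p.length ≤ x) : stepCount v p x = p.count v := by
  rw [stepCount, List.take_of_length_le h]

theorem stepCount_mono (v : Bool) (p : List Bool) : Monotone (stepCount v p) :=
  monotone_nat_of_le_succ fun x => by rw [stepCount_succ]; omega

theorem stepCount_le_self (v : Bool) (p : List Bool) (x : ℕ) : stepCount v p x ≤ x :=
  List.count_le_length.trans (by simp)

theorem stepCount_le_count (v : Bool) (p : List Bool) (x : ℕ) : stepCount v p x ≤ p.count v :=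
  (List.take_sublist x p).count_le v

theorem stepCount_true_add_false (p : List Bool) (x : ℕ) :
    stepCount true p x + stepCount false p x = min x p.length := by
  unfold stepCount
  rw [add_comm, List.count_false_add_count_true, List.length_take]

theorem stepCount_add_not (v : Bool) (p : List Bool) (x : ℕ) :
    stepCount v p x + stepCount (!v) p x = min x p.length := by
  have := stepCount_true_add_false p x
  cases v <;> simp <;> omega

theorem stepCount_append (v : Bool) (p q : List Bool) (x : ℕ) :
    stepCount v (p ++ q) x = stepCount v p x + stepCount v q (x - p.length) := by
  simp [stepCount, List.take_append]

theorem stepCount_cons (v b : Bool) (p : List Bool) (x : ℕ) :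
    stepCount v (b :: p) (x + 1) = stepCount v p x + if b = v then 1 else 0 := by
  simp [stepCount, List.count_cons]

theorem stepCount_lt_of_getElem? (hy : p[y]? = some v) (hxy : x ≤ y) :
    stepCount v p x < stepCount v p (y + 1) := by
  have h1 := stepCount_mono v p hxy
  rw [stepCount_succ, if_pos hy]
  omega

theorem lt_of_stepCount_lt (h : stepCount v p x < stepCount v p y) : x < y := by
  by_contra hle
  have := stepCount_mono v p (not_lt.1 hle)
  omega

/-- The position of the `i`-th step equal to `v`. -/
theorem exists_stepCount_eq {i : ℕ} (hi : 1 ≤ i) (hc : i ≤ p.count v) :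
    ∃ y, p[y]? = some v ∧ stepCount v p y + 1 = i := by
  have hex : ∃ x, i ≤ stepCount v p x := ⟨p.length, by rwa [stepCount_of_length_le le_rfl]⟩
  have h1 := Nat.find_spec hex
  rcases hx : Nat.find hex with _ | y
  · rw [hx, stepCount_zero] at h1
    omega
  · have h2 := Nat.find_min hex (m := y) (by omega)
    rw [hx, stepCount_succ] at h1
    refine ⟨y, ?_, ?_⟩
    · by_contra hne
      rw [if_neg hne] at h1
      omega
    · split_ifs at h1 <;> omega

theorem precedes_not_iff {i j : ℕ} (hi : 1 ≤ i) (hj : 1 ≤ j) (hl : i + j - 1 ≤ p.length) :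
    Precedes (!v) p j i ↔ ¬ Precedes v p i j := by
  have := stepCount_add_not v p (i + j - 1)
  unfold Precedes
  rw [add_comm j i]
  omega

end StepCount

/-- Labels of the first step of each occurrence of two consecutive steps equal to `v`. -/
def doubleLabels (v : Bool) (p : List Bool) : List ℕ :=
  (adjPositions v v p).map fun j => stepCount v p (j + 1)

theorem mem_doubleLabels {v : Bool} {p : List Bool} {i : ℕ} : i ∈ doubleLabels v p ↔
    ∃ j, p[j]? = some v ∧ p[j + 1]? = some v ∧ stepCount v p (j + 1) = i := by
  simp only [doubleLabels, adjPositions, List.mem_map, List.mem_filter, List.mem_range,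
    Bool.and_eq_true, beq_iff_eq]
  constructor
  · rintro ⟨j, ⟨-, h1, h2⟩, h3⟩
    exact ⟨j, h1, h2, h3⟩
  · rintro ⟨j, h1, h2, h3⟩
    refine ⟨j, ⟨?_, h1, h2⟩, h3⟩
    by_contra hlt
    rw [List.getElem?_eq_none (by omega)] at h1
    cases h1

theorem doubleLabels_pairwise (v : Bool) (p : List Bool) :
    (doubleLabels v p).Pairwise (· < ·) := by
  unfold doubleLabels adjPositions
  rw [List.pairwise_map]
  refine List.Pairwise.imp_of_mem (R := (· < ·)) ?_ (List.pairwise_lt_range.filter _)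
  intro a b _ hb hab
  simp only [List.mem_filter, Bool.and_eq_true, beq_iff_eq] at hb
  exact stepCount_lt_of_getElem? hb.2.1 hab

theorem doubleLabels_bounds {v : Bool} {p : List Bool} {i : ℕ} (hi : i ∈ doubleLabels v p) :
    1 ≤ i ∧ i < p.count v := by
  obtain ⟨j, h1, h2, rfl⟩ := mem_doubleLabels.1 hi
  have h3 := stepCount_succ v p j
  have h4 := stepCount_succ v p (j + 1)
  have h5 := stepCount_le_count v p (j + 1 + 1)
  rw [if_pos h1] at h3
  rw [if_pos h2] at h4
  omega

theorem stepCount_mem_doubleLabels {v : Bool} {p : List Bool} {x : ℕ} (hx : p[x]? = some v) :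
    stepCount v p (x + 1) ∈ doubleLabels v p ↔ p[x + 1]? = some v := by
  rw [mem_doubleLabels]
  refine ⟨fun ⟨j, h1, h2, h3⟩ => ?_, fun h => ⟨x, hx, h, rfl⟩⟩
  rcases lt_trichotomy j x with h | rfl | h
  · have := stepCount_lt_of_getElem? hx (show j + 1 ≤ x from h)
    omega
  · exact h2
  · have := stepCount_lt_of_getElem? h1 (show x + 1 ≤ j from h)
    omega

theorem mem_doubleLabels_iff {v : Bool} {p : List Bool} {n i : ℕ} (hv : p.count v = n)
    (hv' : p.count (!v) = n) (hi : 1 ≤ i) (hin : i < n) : i ∈ doubleLabels v p ↔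
      ¬ ∃ j, 1 ≤ j ∧ j ≤ n ∧ Precedes v p i j ∧ ¬ Precedes v p (i + 1) j := by
  have hlen : p.length = 2 * n := by
    have h1 := stepCount_add_not v p p.length
    rw [stepCount_of_length_le le_rfl, stepCount_of_length_le le_rfl] at h1
    omega
  unfold Precedes
  constructor
  · rintro hm ⟨j, hj1, hjn, h1, h2⟩
    obtain ⟨y, hy1, hy2, hy3⟩ := mem_doubleLabels.1 hm
    have h3 := stepCount_succ v p y
    have h4 := stepCount_succ v p (y + 1)
    rw [if_pos hy1] at h3
    rw [if_pos hy2] at h4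
    have h5 : y < i + j - 1 := lt_of_stepCount_lt (v := v) (p := p) (by omega)
    have h6 := stepCount_mono v p (show y + 1 + 1 ≤ i + 1 + j - 1 by omega)
    omega
  · intro hne
    obtain ⟨y, hy1, hy2⟩ := exists_stepCount_eq hi (show i ≤ p.count v by omega)
    have h3 := stepCount_succ v p y
    rw [if_pos hy1] at h3
    rw [mem_doubleLabels]
    refine ⟨y, hy1, ?_, by omega⟩
    by_contra hy
    have h4 := stepCount_succ v p (y + 1)
    rw [if_neg hy] at h4
    have h5 := stepCount_le_self v p y
    have h6 : y + 1 < p.length := by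
      refine lt_of_stepCount_lt (v := v) (p := p) ?_
      rw [stepCount_of_length_le le_rfl]
      omega
    have h7 := stepCount_add_not v p (y + 1 + 1)
    have h8 := stepCount_le_count (!v) p (y + 1 + 1)
    refine hne ⟨y + 2 - i, by omega, by omega, ?_, ?_⟩
    · rw [show i + (y + 2 - i) - 1 = y + 1 by omega]
      omega
    · rw [show i + 1 + (y + 2 - i) - 1 = y + 1 + 1 by omega]
      omega

/-- The number of entries of `l` smaller than `a`. -/
def countBelow (l : List ℕ) (a : ℕ) : ℤ := l.countP (· < a)

theorem countBelow_succ {l : List ℕ} (hl : l.Pairwise (· < ·)) (a : ℕ) :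
    countBelow l (a + 1) = countBelow l a + if a ∈ l then 1 else 0 := by
  have hnd : l.Nodup := hl.imp fun h => h.ne
  have h1 : l.countP (· < a + 1) = l.countP (· < a) + l.count a := by
    clear hl hnd
    induction l with
    | nil => rfl
    | cons b l ih =>
      simp only [List.countP_cons, List.count_cons, ih, decide_eq_true_eq, beq_iff_eq]
      split_ifs <;> omega
  unfold countBelow
  rw [h1, hnd.count]
  push_cast
  rfl

theorem countBelow_one {l : List ℕ} (hl : ∀ i ∈ l, 1 ≤ i) : countBelow l 1 = 0 := by
  unfold countBelow
  rw [List.countP_eq_zero.2]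
  · rfl
  · intro i hi
    have := hl i hi
    simp only [decide_eq_true_eq]
    omega

theorem countBelow_of_lt {l : List ℕ} {n : ℕ} (hl : ∀ i ∈ l, i < n) :
    countBelow l n = l.length := by
  unfold countBelow
  rw [List.countP_eq_length.2]
  intro i hi
  simpa using hl i hi

theorem isDyck_iff {p : List Bool} : IsDyck p ↔
    p.count true = p.count false ∧ ∀ x, stepCount false p x ≤ stepCount true p x := by
  refine and_congr_right fun _ => ⟨fun h x => h _ (List.take_prefix x p), fun h q hq => ?_⟩
  rw [List.prefix_iff_eq_take.1 hq]
  exact h _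

theorem IsDyckN.count_false {n : ℕ} {p : List Bool} (hp : IsDyckN n p) : p.count false = n :=
  hp.1.1.symm.trans hp.2

theorem IsDyckN.length_eq {n : ℕ} {p : List Bool} (hp : IsDyckN n p) : p.length = 2 * n := by
  have h1 := hp.2
  have h2 := hp.count_false
  have h3 := List.count_false_add_count_true p
  omega

theorem IsDyckN.stepCount_le {n : ℕ} {p : List Bool} (hp : IsDyckN n p) (x : ℕ) :
    stepCount false p x ≤ stepCount true p x :=
  (isDyck_iff.1 hp.1).2 x

theorem IsDyckN.precedes {n i j : ℕ} {p : List Bool} (hp : IsDyckN n p) (hij : i ≤ j)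
    (hj : j ≤ n) : Precedes true p i j := by
  have h1 := stepCount_true_add_false p (i + j - 1)
  have h2 := hp.stepCount_le (i + j - 1)
  have h3 := hp.length_eq
  unfold Precedes
  omega

theorem isDyckN_of_precedes {n : ℕ} {p : List Bool} (ht : p.count true = n)
    (hf : p.count false = n) (h : ∀ i, 1 ≤ i → i ≤ n → Precedes true p i i) : IsDyckN n p := by
  refine ⟨isDyck_iff.2 ⟨ht.trans hf.symm, fun x => ?_⟩, ht⟩
  by_contra! hlt
  have h1 := stepCount_true_add_false p x
  have h2 := stepCount_le_count false p x
  have h3 := h (stepCount true p x + 1) (by omega) (by omega)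
  unfold Precedes at h3
  have h4 : x < stepCount true p x + 1 + (stepCount true p x + 1) - 1 :=
    lt_of_stepCount_lt (v := true) (p := p) (by omega)
  have h5 := List.count_false_add_count_true p
  omega

/-- The relative order of the up- and downsteps of `p` is encoded by two slowly growing functions:
the `i`-th upstep precedes the `j`-th downstep iff `α i ≤ δ j`. -/
structure HasCode (n : ℕ) (p : List Bool) (α δ : ℕ → ℤ) : Prop where
  count_true : p.count true = n
  count_false : p.count false = n
  up_one : α 1 = 0
  down_one : δ 1 = 0
  up_step : ∀ i, 1 ≤ i → i < n → α (i + 1) = α i ∨ α (i + 1) = α i + 1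
  down_step : ∀ i, 1 ≤ i → i < n → δ (i + 1) = δ i ∨ δ (i + 1) = δ i + 1
  last : α n = δ n
  precedes_iff : ∀ i j, 1 ≤ i → i ≤ n → 1 ≤ j → j ≤ n → (Precedes true p i j ↔ α i ≤ δ j)

section SlowGrowth

variable {n : ℕ} {f : ℕ → ℤ}

theorem le_of_slowGrowth (h : ∀ i, 1 ≤ i → i < n → f (i + 1) = f i ∨ f (i + 1) = f i + 1) {i j : ℕ}
    (hi : 1 ≤ i) (hij : i ≤ j) (hj : j ≤ n) : f i ≤ f j ∧ f j - f i ≤ j - i := by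
  induction j, hij using Nat.le_induction with
  | base => simp
  | succ j hij ih =>
    have h1 := ih (by omega)
    have h2 := h j (by omega) (by omega)
    push_cast
    omega

theorem exists_eq_of_slowGrowth
    (h : ∀ i, 1 ≤ i → i < n → f (i + 1) = f i ∨ f (i + 1) = f i + 1) {i j : ℕ}
    (hi : 1 ≤ i) (hij : i ≤ j) (hj : j ≤ n) {v : ℤ} (hv : f i ≤ v) (hv' : v ≤ f j) :
    ∃ k, 1 ≤ k ∧ k ≤ n ∧ f k = v := by
  induction j, hij using Nat.le_induction with
  | base => exact ⟨i, hi, hj, by omega⟩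
  | succ j hij ih =>
    by_cases hle : v ≤ f j
    · exact ih (by omega) hle
    · have h2 := h j (by omega) (by omega)
      exact ⟨j + 1, by omega, hj, by omega⟩

end SlowGrowth

namespace HasCode

variable {n : ℕ} {p : List Bool} {α δ : ℕ → ℤ}

theorem length_eq (h : HasCode n p α δ) : p.length = 2 * n := by
  have h1 := h.count_true
  have h2 := h.count_false
  have h3 := List.count_false_add_count_true p
  omega

theorem mem_doubleLabels_true (h : HasCode n p α δ) {i : ℕ} (hi : 1 ≤ i) (hin : i < n) :
    i ∈ doubleLabels true p ↔ α (i + 1) = α i := by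
  rw [mem_doubleLabels_iff h.count_true h.count_false hi hin]
  have h0 := h.up_step i hi hin
  constructor
  · intro hne
    by_contra h1
    obtain ⟨j, hj1, hjn, hj⟩ := exists_eq_of_slowGrowth h.down_step (v := α i) le_rfl
      (show 1 ≤ n by omega) le_rfl
      (by have := le_of_slowGrowth h.up_step le_rfl hi hin.le
          rw [h.down_one, ← h.up_one]; exact this.1)
      (by have := le_of_slowGrowth h.up_step hi hin.le le_rfl
          rw [← h.last]; exact this.1)
    refine hne ⟨j, hj1, hjn, ?_, ?_⟩
    · rw [h.precedes_iff _ _ hi hin.le hj1 hjn]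
      omega
    · rw [h.precedes_iff _ _ (by omega) (by omega) hj1 hjn]
      omega
  · rintro h1 ⟨j, hj1, hjn, h2, h3⟩
    rw [h.precedes_iff _ _ hi hin.le hj1 hjn] at h2
    rw [h.precedes_iff _ _ (by omega) (by omega) hj1 hjn] at h3
    omega

theorem mem_doubleLabels_false (h : HasCode n p α δ) {i : ℕ} (hi : 1 ≤ i) (hin : i < n) :
    i ∈ doubleLabels false p ↔ δ (i + 1) = δ i := by
  rw [mem_doubleLabels_iff h.count_false h.count_true hi hin]
  have h0 := h.down_step i hi hin
  have hl := h.length_eq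
  have key : ∀ i j, 1 ≤ i → i ≤ n → 1 ≤ j → j ≤ n → (Precedes false p j i ↔ δ j < α i) := by
    intro i j hi hin hj hjn
    have h1 := precedes_not_iff (v := true) (p := p) hi hj (by omega)
    rwa [h.precedes_iff i j hi hin hj hjn, not_le] at h1
  constructor
  · intro hne
    by_contra h1
    obtain ⟨j, hj1, hjn, hj⟩ := exists_eq_of_slowGrowth h.up_step (v := δ i + 1) le_rfl
      (show 1 ≤ n by omega) le_rfl
      (by have := le_of_slowGrowth h.down_step le_rfl hi hin.le
          have := h.down_one
          have := h.up_one
          omega)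
      (by have := le_of_slowGrowth h.down_step (show 1 ≤ i + 1 by omega) hin le_rfl
          rw [h.last]; omega)
    refine hne ⟨j, hj1, hjn, ?_, ?_⟩
    · rw [key _ _ hj1 hjn hi hin.le]
      omega
    · rw [key _ _ hj1 hjn (by omega) (by omega)]
      omega
  · rintro h1 ⟨j, hj1, hjn, h2, h3⟩
    rw [key _ _ hj1 hjn hi hin.le] at h2
    rw [key _ _ hj1 hjn (by omega) (by omega)] at h3
    omega

theorem countBelow_true (h : HasCode n p α δ) {a : ℕ} (ha : 1 ≤ a) (han : a ≤ n) :
    countBelow (doubleLabels true p) a = a - 1 - α a := by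
  induction a, ha using Nat.le_induction with
  | base =>
    rw [countBelow_one fun i hi => (doubleLabels_bounds hi).1, h.up_one]
    simp
  | succ a ha ih =>
    rw [countBelow_succ (doubleLabels_pairwise _ _), ih (by omega)]
    have h1 := h.up_step a ha (by omega)
    have h2 := h.mem_doubleLabels_true ha (by omega)
    push_cast
    split_ifs with h3
    · rw [h2] at h3
      omega
    · rw [h2] at h3
      omega

theorem countBelow_false (h : HasCode n p α δ) {a : ℕ} (ha : 1 ≤ a) (han : a ≤ n) :
    countBelow (doubleLabels false p) a = a - 1 - δ a := by
  induction a, ha using Nat.le_induction with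
  | base =>
    rw [countBelow_one fun i hi => (doubleLabels_bounds hi).1, h.down_one]
    simp
  | succ a ha ih =>
    rw [countBelow_succ (doubleLabels_pairwise _ _), ih (by omega)]
    have h1 := h.down_step a ha (by omega)
    have h2 := h.mem_doubleLabels_false ha (by omega)
    push_cast
    split_ifs with h3
    · rw [h2] at h3
      omega
    · rw [h2] at h3
      omega

end HasCode

/-- The number of non-double steps equal to `v` among the first `a - 1` ones. -/
def singleCount (v : Bool) (p : List Bool) (a : ℕ) : ℤ := a - 1 - countBelow (doubleLabels v p) a

theorem singleCount_one (v : Bool) (p : List Bool) : singleCount v p 1 = 0 := by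
  rw [singleCount, countBelow_one fun i hi => (doubleLabels_bounds hi).1]
  simp

theorem singleCount_succ (v : Bool) (p : List Bool) (a : ℕ) : singleCount v p (a + 1) =
    singleCount v p a + if a ∈ doubleLabels v p then 0 else 1 := by
  rw [singleCount, singleCount, countBelow_succ (doubleLabels_pairwise _ _)]
  push_cast
  split_ifs <;> ring

theorem singleCount_step (v : Bool) (p : List Bool) (a : ℕ) :
    singleCount v p (a + 1) = singleCount v p a ∨ singleCount v p (a + 1) = singleCount v p a + 1 := by
  rw [singleCount_succ]
  split_ifs <;> simp

theorem IsDyckN.singleCount_walk {n : ℕ} {p : List Bool} (hp : IsDyckN n p) {x : ℕ} (hx : x < 2 * n) :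
    (p[x]? = some true ∧ singleCount true p (stepCount true p (x + 1)) =
      singleCount false p (stepCount false p (x + 1) + 1)) ∨
    (p[x]? = some false ∧ singleCount true p (stepCount true p (x + 1) + 1) =
      singleCount false p (stepCount false p (x + 1)) + 1) := by
  have hl := hp.length_eq
  have step : ∀ y, y < 2 * n → p[y]? = some true ∨ p[y]? = some false := by
    intro y hy
    rw [List.getElem?_eq_getElem (by omega)]
    cases p[y] <;> simp
  induction x with
  | zero =>
    have h0 := stepCount_succ true p 0
    have h1 := stepCount_succ false p 0
    have h2 := hp.stepCount_le (0 + 1)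
    rw [stepCount_zero] at h0 h1
    rcases step 0 hx with h | h
    · refine Or.inl ⟨h, ?_⟩
      rw [if_pos h] at h0
      rw [if_neg (by rw [h]; simp)] at h1
      rw [h0, h1]
      simp [singleCount_one]
    · rw [if_pos h] at h1
      rw [if_neg (by rw [h]; simp)] at h0
      omega
  | succ x ih =>
    have h0 := stepCount_succ true p (x + 1)
    have h1 := stepCount_succ false p (x + 1)
    rcases ih (by omega) with ⟨hx0, ih⟩ | ⟨hx0, ih⟩
    · have h2 := singleCount_succ true p (stepCount true p (x + 1))
      simp only [stepCount_mem_doubleLabels hx0] at h2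
      rcases step (x + 1) hx with h | h
      · refine Or.inl ⟨h, ?_⟩
        rw [if_pos h] at h0 h2
        rw [if_neg (by rw [h]; simp)] at h1
        rw [h0, h1, h2, ih]
        simp
      · refine Or.inr ⟨h, ?_⟩
        rw [if_pos h] at h1
        rw [if_neg (by rw [h]; simp)] at h0 h2
        rw [h0, h1, add_zero, h2, ih]
    · have h2 := singleCount_succ false p (stepCount false p (x + 1))
      simp only [stepCount_mem_doubleLabels hx0] at h2
      rcases step (x + 1) hx with h | h
      · refine Or.inl ⟨h, ?_⟩
        rw [if_pos h] at h0
        rw [if_neg (by rw [h]; simp)] at h1 h2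
        rw [h0, h1, add_zero, h2, ih]
      · refine Or.inr ⟨h, ?_⟩
        rw [if_pos h] at h1 h2
        rw [if_neg (by rw [h]; simp)] at h0
        rw [h0, h1, h2, add_zero, ih]
        simp

theorem IsDyckN.hasCode {n : ℕ} {p : List Bool} (hp : IsDyckN n p) :
    HasCode n p (singleCount true p) (singleCount false p) := by
  have hl := hp.length_eq
  refine ⟨hp.2, hp.count_false, singleCount_one _ _, singleCount_one _ _,
    fun i _ _ => singleCount_step _ _ _, fun i _ _ => singleCount_step _ _ _, ?_, ?_⟩
  · rcases Nat.eq_zero_or_pos n with rfl | hn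
    · simp only [singleCount, countBelow]
      have : p = [] := List.length_eq_zero_iff.1 (by omega)
      subst this
      rfl
    · have h0 := hp.singleCount_walk (show 2 * n - 1 < 2 * n by omega)
      have h1 := stepCount_succ true p (2 * n - 1)
      have h2 := stepCount_succ false p (2 * n - 1)
      have h3 := hp.stepCount_le (2 * n - 1)
      rw [show 2 * n - 1 + 1 = 2 * n by omega] at h0 h1 h2
      rw [stepCount_of_length_le hl.le] at h0 h1 h2
      rw [stepCount_of_length_le hl.le] at h0
      rw [hp.2] at h0 h1
      rw [hp.count_false] at h0 h2
      rcases h0 with ⟨h, -⟩ | ⟨h, h0⟩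
      · rw [if_pos h] at h1
        rw [if_neg (by rw [h]; simp)] at h2
        omega
      · rw [singleCount_succ, if_neg] at h0
        · omega
        · intro hm
          have h4 := (doubleLabels_bounds hm).2
          have h5 := hp.2
          omega
  · intro i j hi hin hj hjn
    have mono : ∀ v a b, 1 ≤ a → a ≤ b → b ≤ n → singleCount v p a ≤ singleCount v p b :=
      fun v a b h1 h2 h3 => (le_of_slowGrowth (n := n) (fun i _ _ => singleCount_step v p i) h1 h2 h3).1
    constructor
    · intro h
      obtain ⟨y, hy, hyi⟩ := exists_stepCount_eq hi (hin.trans hp.2.ge)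
      have h1 := stepCount_succ true p y
      rw [if_pos hy] at h1
      unfold Precedes at h
      have h2 : y < i + j - 1 := lt_of_stepCount_lt (v := true) (p := p) (by omega)
      have h3 := stepCount_true_add_false p (y + 1)
      rcases hp.singleCount_walk (show y < 2 * n by omega) with ⟨-, h4⟩ | ⟨h4, -⟩
      · rw [show stepCount true p (y + 1) = i by omega] at h4
        rw [h4]
        exact mono _ _ _ (by omega) (by omega) hjn
      · rw [hy] at h4
        cases h4
    · intro h
      by_contra hne
      obtain ⟨y, hy, hyi⟩ := exists_stepCount_eq hj (hjn.trans hp.count_false.ge)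
      have h1 := stepCount_succ false p y
      rw [if_pos hy] at h1
      unfold Precedes at hne
      have h5 := stepCount_true_add_false p (i + j - 1)
      have h2 : y < i + j - 1 := lt_of_stepCount_lt (v := false) (p := p) (by omega)
      have h3 := stepCount_true_add_false p (y + 1)
      rcases hp.singleCount_walk (show y < 2 * n by omega) with ⟨h4, -⟩ | ⟨-, h4⟩
      · rw [hy] at h4
        cases h4
      · rw [show stepCount false p (y + 1) = j by omega] at h4
        have := mono true (stepCount true p (y + 1) + 1) i (by omega) (by omega) hin
        omega

/-- The path whose ascents and descents end at the successive upsteps labelled by `A` and downsteps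
labelled by `D`, when the labelling starts after `a₀` and `d₀`. -/
def blockPath : ℕ → ℕ → List ℕ → List ℕ → List Bool
  | a₀, d₀, a :: A, d :: D =>
    List.replicate (a - a₀) true ++ (List.replicate (d - d₀) false ++ blockPath a d A D)
  | _, _, _, _ => []

theorem pathOfCode_eq_blockPath (n : ℕ) (A D : List ℕ) :
    pathOfCode n A D = blockPath 0 0 (A ++ [n]) (D ++ [n]) := by
  unfold pathOfCode
  simp only
  generalize A ++ [n] = A
  generalize D ++ [n] = D
  suffices ∀ a₀ d₀ : ℕ, (List.zipWith (fun x y => List.replicate x true ++ List.replicate y false)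
      (List.zipWith (· - ·) A (a₀ :: A)) (List.zipWith (· - ·) D (d₀ :: D))).flatten =
      blockPath a₀ d₀ A D from this 0 0
  induction A generalizing D with
  | nil => intro a₀ d₀; simp [blockPath]
  | cons a A ih =>
    intro a₀ d₀
    rcases D with _ | ⟨d, D⟩
    · simp [blockPath]
    · have := ih D a d
      simp [blockPath, ← this]

theorem count_blockPath {A D : List ℕ} (hAD : A.length = D.length) {a₀ d₀ : ℕ}
    (hA : (a₀ :: A).Pairwise (· < ·)) (hD : (d₀ :: D).Pairwise (· < ·)) :
    a₀ + (blockPath a₀ d₀ A D).count true = A.getLastD a₀ ∧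
      d₀ + (blockPath a₀ d₀ A D).count false = D.getLastD d₀ := by
  induction A generalizing D a₀ d₀ with
  | nil =>
    have : D = [] := List.length_eq_zero_iff.1 hAD.symm
    subst this
    simp [blockPath]
  | cons a A ih =>
    rcases D with _ | ⟨d, D⟩
    · simp at hAD
    · rw [List.pairwise_cons] at hA hD
      have h1 := ih (by simpa using hAD) hA.2 hD.2
      have h2 := hA.1 a (by simp)
      have h3 := hD.1 d (by simp)
      simp only [blockPath, List.count_append, List.count_replicate, List.getLastD_cons, ← h1.1,
        ← h1.2]
      simp
      omega

theorem stepCount_replicate (v w : Bool) (k x : ℕ) :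
    stepCount v (List.replicate k w) x = if w = v then min x k else 0 := by
  simp [stepCount, List.take_replicate, List.count_replicate]

theorem le_stepCount_blockPath_iff {A D : List ℕ} (hAD : A.length = D.length) {a₀ d₀ a b : ℕ}
    (hA : (a₀ :: A).Pairwise (· < ·)) (hD : (d₀ :: D).Pairwise (· < ·)) (ha : a₀ < a) (hb : d₀ < b)
    (ha' : a ≤ A.getLastD a₀) (hb' : b ≤ D.getLastD d₀) :
    a ≤ a₀ + stepCount true (blockPath a₀ d₀ A D) (a + b - 1 - a₀ - d₀) ↔
      A.countP (· < a) ≤ D.countP (· < b) := by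
  induction A generalizing D a₀ d₀ with
  | nil =>
    simp at ha'
    omega
  | cons a₁ A ih =>
    rcases D with _ | ⟨d₁, D⟩
    · simp at hAD
    · rw [List.pairwise_cons] at hA hD
      have h2 := hA.1 a₁ (by simp)
      have h3 := hD.1 d₁ (by simp)
      rw [List.getLastD_cons] at ha' hb'
      simp only [blockPath, stepCount_append, stepCount_replicate, List.length_replicate,
        List.countP_cons, decide_eq_true_eq, if_true, Bool.false_eq_true,
        if_false, zero_add]
      have zero : ∀ (l : List ℕ) (c e : ℕ), (c :: l).Pairwise (· < ·) → e ≤ c →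
          l.countP (· < e) = 0 := by
        intro l c e hl hce
        rw [List.countP_eq_zero]
        intro x hx
        have := (List.pairwise_cons.1 hl).1 x hx
        simp only [decide_eq_true_eq]
        omega
      by_cases haa : a ≤ a₁
      · rw [zero A a₁ a hA.2 haa]
        constructor
        · intro _
          split_ifs <;> omega
        · omega
      · by_cases hbd : b ≤ d₁
        · rw [zero D d₁ b hD.2 hbd]
          have := stepCount_le_self true (blockPath a₁ d₁ A D)
            (a + b - 1 - a₀ - d₀ - (a₁ - a₀) - (d₁ - d₀))
          constructor
          · intro _
            omega
          · split_ifs <;> omega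
        · have h4 := ih (by simpa using hAD) hA.2 hD.2 (by omega) (by omega) ha' hb'
          rw [if_pos (by omega), if_pos (by omega), add_le_add_iff_right, ← h4,
            show a + b - 1 - a₀ - d₀ - (a₁ - a₀) - (d₁ - d₀) = a + b - 1 - a₁ - d₁ by omega]
          omega

theorem HasCode.lmap {n : ℕ} {p : List Bool} {α δ : ℕ → ℤ} (hn : 1 ≤ n) (h : HasCode n p α δ) :
    HasCode n (Lmap p) (fun a => a - 1 - δ a) (fun b => b - 1 - α b) := by
  have hlt : ∀ v, ∀ i ∈ doubleLabels v p, i < n := by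
    intro v i hi
    have h1 := (doubleLabels_bounds hi).2
    have h2 := h.count_true
    have h3 := h.count_false
    cases v <;> omega
  have hlen : (doubleLabels false p).length = (doubleLabels true p).length := by
    have h1 := h.countBelow_true hn le_rfl
    have h2 := h.countBelow_false hn le_rfl
    rw [countBelow_of_lt (hlt _)] at h1 h2
    have := h.last
    omega
  have hpw : ∀ v, (0 :: (doubleLabels v p ++ [n])).Pairwise (· < ·) := by
    intro v
    simp only [List.pairwise_cons, List.pairwise_append, List.mem_append, List.mem_singleton]
    refine ⟨?_, doubleLabels_pairwise v p, by simp, fun i hi j hj => hj ▸ hlt v i hi⟩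
    rintro i (hi | rfl)
    · exact (doubleLabels_bounds hi).1
    · exact hn
  have hlast : ∀ v, (doubleLabels v p ++ [n]).getLastD 0 = n := by simp
  have hL : Lmap p = blockPath 0 0 (doubleLabels false p ++ [n]) (doubleLabels true p ++ [n]) := by
    rw [← pathOfCode_eq_blockPath, ← h.count_true]
    rfl
  have hlen' : (doubleLabels false p ++ [n]).length = (doubleLabels true p ++ [n]).length := by
    simp [hlen]
  have hc := count_blockPath hlen' (hpw false) (hpw true)
  rw [hlast, hlast, ← hL, zero_add, zero_add] at hc
  refine ⟨hc.1, hc.2, by simp [h.down_one], by simp [h.up_one], ?_, ?_, by simp [h.last], ?_⟩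
  · intro i hi hin
    have := h.down_step i hi hin
    push_cast
    omega
  · intro i hi hin
    have := h.up_step i hi hin
    push_cast
    omega
  · intro i j hi hin hj hjn
    have h1 := le_stepCount_blockPath_iff hlen' (hpw false) (hpw true) hi hj
      (hin.trans (hlast _).ge) (hjn.trans (hlast _).ge)
    rw [← hL, zero_add] at h1
    rw [← h.countBelow_true hj hjn, ← h.countBelow_false hi hin]
    unfold Precedes
    rw [show i + j - 1 = i + j - 1 - 0 - 0 by omega, h1]
    simp only [List.countP_append, List.countP_singleton, decide_eq_true_eq]
    rw [if_neg (by omega), if_neg (by omega), countBelow, countBelow]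
    omega

theorem IsDyckN.lmap {n : ℕ} {p : List Bool} (hp : IsDyckN n p) : IsDyckN n (Lmap p) := by
  rcases Nat.eq_zero_or_pos n with rfl | hn
  · have := hp.length_eq
    have : p = [] := List.length_eq_zero_iff.1 (by omega)
    subst this
    exact hp
  · have h := hp.hasCode
    have h' := h.lmap hn
    refine isDyckN_of_precedes h'.count_true h'.count_false fun i hi hin => ?_
    rw [h'.precedes_iff i i hi hin hi hin]
    have := (h.precedes_iff i i hi hin hi hin).1 (hp.precedes le_rfl hin)
    omega

theorem componentsAux_congr {k l : ℕ} {p : List Bool} (hk : p.length ≤ k) (hl : p.length ≤ l) :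
    componentsAux k p = componentsAux l p := by
  induction k generalizing l p with
  | zero =>
    have : p = [] := List.length_eq_zero_iff.1 (by omega)
    subst this
    cases l <;> rfl
  | succ k ih =>
    rcases p with _ | ⟨b, p⟩
    · cases l <;> rfl
    · rcases l with _ | l
      · simp at hl
      · simp only [componentsAux]
        rw [ih]
        all_goals
          simp only [List.length_drop, List.length_cons] at hk hl ⊢
          omega

theorem IsDyckN.firstReturn_spec {n : ℕ} {p : List Bool} (hp : IsDyckN n p) (hn : 1 ≤ n) :
    1 ≤ firstReturn p ∧ firstReturn p ≤ p.length ∧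
      stepCount true p (firstReturn p) = stepCount false p (firstReturn p) ∧
      ∀ k, 1 ≤ k → k < firstReturn p → stepCount false p k < stepCount true p k := by
  have hl := hp.length_eq
  unfold firstReturn
  split
  · next j hj =>
    rw [List.find?_range'_eq_some] at hj
    obtain ⟨h1, h2, h3⟩ := hj
    simp only [List.mem_range'_1, beq_iff_eq, Bool.not_eq_eq_eq_not, Bool.not_true,
      beq_eq_false_iff_ne] at h1 h2 h3
    refine ⟨by omega, by omega, h1, fun k hk hkj => ?_⟩
    exact lt_of_le_of_ne (hp.stepCount_le k) fun he => h3 k hk hkj he.symm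
  · next hj =>
    rw [List.find?_eq_none] at hj
    refine absurd ?_ (hj p.length (by simp; omega))
    simp [hp.1.1]

theorem IsDyckN.exists_firstComponent {n : ℕ} {p : List Bool} (hp : IsDyckN n p) (hn : 1 ≤ n) :
    ∃ s m P Y, n = s + 1 + m ∧ IsDyckN s P ∧ IsDyckN m Y ∧ p = true :: (P ++ false :: Y) ∧
      ∀ F, pathDeriv F p = true :: (F P ++ false :: pathDeriv F Y) := by
  obtain ⟨hj1, hjl, hj, hmin⟩ := hp.firstReturn_spec hn
  have hl := hp.length_eq
  set j := firstReturn p with hjdef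
  have hj2 : 2 ≤ j := by
    have := stepCount_true_add_false p j
    omega
  obtain ⟨b₀, P, b, hT⟩ : ∃ b₀ P b, p.take j = b₀ :: (P ++ [b]) := by
    rcases hT : p.take j with _ | ⟨b₀, T⟩
    · have := congrArg List.length hT
      simp only [List.length_take, List.length_nil] at this
      omega
    · rcases List.eq_nil_or_concat T with rfl | ⟨P, b, rfl⟩
      · have := congrArg List.length hT
        simp at this
        omega
      · exact ⟨b₀, P, b, by simp⟩
  have hlP : P.length + 2 = j := by
    have := congrArg List.length hT
    simp at this
    omega
  have hpe : p = b₀ :: (P ++ b :: p.drop j) := by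
    conv_lhs => rw [← List.take_append_drop j p, hT]
    simp
  have hdyck := hp.stepCount_le
  have hstep : ∀ v x, x ≤ P.length →
      stepCount v p (x + 1) = stepCount v P x + if b₀ = v then 1 else 0 := by
    intro v x hx
    conv_lhs => rw [hpe]
    rw [stepCount_cons, stepCount_append, Nat.sub_eq_zero_of_le hx, stepCount_zero, add_zero]
  have hstep' : ∀ v x, stepCount v p (j + x) = P.count v + (if b₀ = v then 1 else 0) +
      (if b = v then 1 else 0) + stepCount v (p.drop j) x := by
    intro v x
    conv_lhs => rw [hpe]
    rw [← hlP, show P.length + 2 + x = P.length + (x + 1) + 1 by omega, stepCount_cons,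
      stepCount_append, stepCount_of_length_le (by omega),
      show P.length + (x + 1) - P.length = x + 1 by omega, stepCount_cons]
    ring
  obtain rfl : b₀ = true := by
    have h1 := hdyck (0 + 1)
    rw [hstep _ _ (by omega), hstep _ _ (by omega), stepCount_zero, stepCount_zero] at h1
    by_contra hb
    simp at hb
    subst hb
    simp at h1
  have hlastP := hmin (P.length + 1) (by omega) (by omega)
  rw [hstep _ _ le_rfl, hstep _ _ le_rfl, stepCount_of_length_le le_rfl,
    stepCount_of_length_le le_rfl] at hlastP
  have hjt := hstep' true 0
  have hjf := hstep' false 0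
  rw [add_zero, stepCount_zero] at hjt hjf
  obtain rfl : b = false := by
    by_contra hb
    simp at hb
    subst hb
    simp at hjt hjf hlastP
    omega
  simp only [if_true, Bool.true_eq_false, Bool.false_eq_true, if_false] at *
  have hcP : P.count true = P.count false := by omega
  have hct := hstep' true (p.length)
  have hcf := hstep' false (p.length)
  rw [stepCount_of_length_le (by omega), stepCount_of_length_le (by simp)] at hct hcf
  simp only [if_true, Bool.true_eq_false, Bool.false_eq_true, if_false] at hct hcf
  have hpt := hp.2
  have hpf := hp.count_false
  refine ⟨P.count true, (p.drop j).count true, P, p.drop j, by omega, ⟨isDyck_iff.2 ⟨hcP, ?_⟩, rfl⟩,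
    ⟨isDyck_iff.2 ⟨by omega, ?_⟩, rfl⟩, hpe, ?_⟩
  · intro x
    rcases le_total P.length x with hx | hx
    · rw [stepCount_of_length_le hx, stepCount_of_length_le hx]
      omega
    · have := hmin (x + 1) (by omega) (by omega)
      rw [hstep _ _ hx, hstep _ _ hx] at this
      simp at this
      omega
  · intro x
    have := hdyck (j + x)
    rw [hstep', hstep'] at this
    simp at this
    omega
  · intro F
    have hc : components p = p.take j :: components (p.drop j) := by
      unfold components
      rcases hlp : p.length with _ | k
      · omega
      · rcases hp' : p with _ | ⟨c, q⟩
        · simp [hp'] at hlp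
        · rw [← hp']
          have : componentsAux (k + 1) p = p.take (max 1 (firstReturn p)) ::
              componentsAux k (p.drop (max 1 (firstReturn p))) := by
            rw [hp']
            rfl
          rw [this, ← hjdef, max_eq_right hj1]
          congr 1
          apply componentsAux_congr
          · simp
            omega
          · simp
    unfold pathDeriv
    rw [hc, List.map_cons, List.flatten_cons, hT]
    simp

section Elevate

variable {s m : ℕ} {P Y : List Bool}

theorem stepCount_elevate_append (v : Bool) (hP : IsDyckN s P) {x : ℕ} (hx : x ≤ 2 * s) :
    stepCount v (true :: (P ++ false :: Y)) (x + 1) =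
      stepCount v P x + if true = v then 1 else 0 := by
  have := hP.length_eq
  rw [stepCount_cons, stepCount_append, Nat.sub_eq_zero_of_le (by omega), stepCount_zero, add_zero]

theorem stepCount_elevate_append_add (v : Bool) (hP : IsDyckN s P) (x : ℕ) :
    stepCount v (true :: (P ++ false :: Y)) (2 * s + 2 + x) = s + 1 + stepCount v Y x := by
  have h1 := hP.length_eq
  have h2 := hP.2
  have h3 := hP.count_false
  rw [show 2 * s + 2 + x = P.length + (x + 1) + 1 by omega, stepCount_cons,
      stepCount_append, stepCount_of_length_le (by omega),
      show P.length + (x + 1) - P.length = x + 1 by omega, stepCount_cons]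
  cases v <;> simp <;> omega

theorem IsDyckN.elevate_append (hP : IsDyckN s P) (hY : IsDyckN m Y) :
    IsDyckN (s + 1 + m) (true :: (P ++ false :: Y)) := by
  have h2 := hP.2
  have h3 := hP.count_false
  have h4 := hY.2
  have h5 := hY.count_false
  refine ⟨isDyck_iff.2 ⟨by simp; omega, fun x => ?_⟩, by simp; omega⟩
  rcases le_or_gt (2 * s + 2) x with hx | hx
  · obtain ⟨x, rfl⟩ := Nat.exists_eq_add_of_le hx
    rw [stepCount_elevate_append_add _ hP, stepCount_elevate_append_add _ hP]
    have := hY.stepCount_le x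
    omega
  · rcases x with _ | x
    · simp [stepCount_zero]
    · rw [stepCount_elevate_append _ hP (by omega), stepCount_elevate_append _ hP (by omega)]
      have := hP.stepCount_le x
      simp
      omega

theorem precedes_elevate_append_left (hP : IsDyckN s P) {i j : ℕ} (hi : 1 ≤ i)
    (hin : i ≤ s) (hjn : j ≤ s) :
    Precedes true (true :: (P ++ false :: Y)) (i + 1) j ↔ Precedes true P i j := by
  unfold Precedes
  rw [show i + 1 + j - 1 = i + j - 1 + 1 by omega, stepCount_elevate_append _ hP (by omega)]
  simp

theorem precedes_elevate_append_right (hP : IsDyckN s P) {i j : ℕ} (hi : 1 ≤ i) :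
    Precedes true (true :: (P ++ false :: Y)) (s + 1 + i) (s + 1 + j) ↔ Precedes true Y i j := by
  unfold Precedes
  rw [show s + 1 + i + (s + 1 + j) - 1 = 2 * s + 2 + (i + j - 1) by omega,
    stepCount_elevate_append_add _ hP]
  omega

theorem not_precedes_elevate_append (hP : IsDyckN s P) {i j : ℕ} (hi : s + 1 < i)
    (hj : j ≤ s + 1) : ¬ Precedes true (true :: (P ++ false :: Y)) i j := by
  unfold Precedes
  rcases le_or_gt (2 * s + 2) (i + j - 1) with hx | hx
  · obtain ⟨x, hx⟩ := Nat.exists_eq_add_of_le hx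
    rw [hx, stepCount_elevate_append_add _ hP]
    have := stepCount_le_self true Y x
    omega
  · rw [show i + j - 1 = i + j - 2 + 1 by omega, stepCount_elevate_append _ hP (by omega)]
    have h1 := stepCount_le_count true P (i + j - 2)
    have h2 := hP.2
    simp
    omega

theorem HasCode.left {α δ : ℕ → ℤ} (hP : IsDyckN s P) (hs : 1 ≤ s)
    (h : HasCode (s + 1 + m) (true :: (P ++ false :: Y)) α δ) :
    HasCode s P (fun i => α (i + 1)) δ := by
  have key : ∀ i j, 1 ≤ i → i ≤ s → 1 ≤ j → j ≤ s → (Precedes true P i j ↔ α (i + 1) ≤ δ j) := by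
    intro i j hi hin hj hjn
    rw [← precedes_elevate_append_left (Y := Y) hP hi hin hjn,
      h.precedes_iff _ _ (by omega) (by omega) hj (by omega)]
  refine ⟨hP.2, hP.count_false, ?_, h.down_one, fun i hi hin => h.up_step _ (by omega) (by omega),
    fun i hi hin => h.down_step _ (by omega) (by omega), ?_, key⟩
  · have h1 := (key 1 1 le_rfl hs le_rfl hs).1 (hP.precedes le_rfl hs)
    have h2 := h.up_step 1 le_rfl (by omega)
    have h3 := h.up_one
    have h4 := h.down_one
    omega
  · have h1 := (key s s hs le_rfl hs le_rfl).1 (hP.precedes le_rfl le_rfl)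
    refine le_antisymm h1 ?_
    rcases Nat.eq_zero_or_pos m with rfl | hm
    · have h2 := h.last
      have h3 := h.down_step s hs (by omega)
      simp only [add_zero] at h2
      omega
    · have h2 := not_precedes_elevate_append (Y := Y) hP (show s + 1 < s + 2 by omega)
        (show s ≤ s + 1 by omega)
      rw [h.precedes_iff _ _ (by omega) (by omega) (by omega) (by omega)] at h2
      have h3 := h.up_step (s + 1) (by omega) (by omega)
      rw [show s + 1 + 1 = s + 2 from rfl] at h3
      omega

theorem HasCode.right {α δ : ℕ → ℤ} (hP : IsDyckN s P) (hY : IsDyckN m Y) (hm : 1 ≤ m)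
    (h : HasCode (s + 1 + m) (true :: (P ++ false :: Y)) α δ) :
    HasCode m Y (fun i => α (s + 1 + i) - α (s + 2)) (fun j => δ (s + 1 + j) - α (s + 2)) := by
  have key : ∀ i j, 1 ≤ i → i ≤ m → 1 ≤ j → j ≤ m →
      (Precedes true Y i j ↔ α (s + 1 + i) ≤ δ (s + 1 + j)) := by
    intro i j hi hin hj hjn
    rw [← precedes_elevate_append_right (Y := Y) hP hi,
      h.precedes_iff _ _ (by omega) (by omega) (by omega) (by omega)]
  refine ⟨hY.2, hY.count_false, by ring_nf, ?_, ?_, ?_, ?_, ?_⟩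
  · have h1 := (key 1 1 le_rfl hm le_rfl hm).1 (hY.precedes le_rfl hm)
    have h2 := not_precedes_elevate_append (Y := Y) hP (show s + 1 < s + 2 by omega)
        (show s + 1 ≤ s + 1 by omega)
    rw [h.precedes_iff _ _ (by omega) (by omega) (by omega) (by omega)] at h2
    have h3 := h.down_step (s + 1) (by omega) (by omega)
    simp only [show s + 1 + 1 = s + 2 from rfl] at h1 h3 ⊢
    omega
  · intro i hi hin
    have := h.up_step (s + 1 + i) (by omega) (by omega)
    simp only [← add_assoc]
    omega
  · intro i hi hin
    have := h.down_step (s + 1 + i) (by omega) (by omega)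
    simp only [← add_assoc]
    omega
  · simp only [h.last]
  · intro i j hi hin hj hjn
    rw [key i j hi hin hj hjn]
    simp

end Elevate

/-- The order of the steps of `L' Q` in terms of a code of `Q`. -/
theorem IsDyckN.pathDeriv_lmap {n : ℕ} {Q : List Bool} (hQ : IsDyckN n Q) :
    IsDyckN n (pathDeriv Lmap Q) ∧ ∀ α δ, HasCode n Q α δ → ∀ a b : ℕ, 1 ≤ b → b < a → a ≤ n →
      (Precedes true (pathDeriv Lmap Q) a b ↔ (a : ℤ) - 1 - δ (a - 1) ≤ b - α (b + 1)) := by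
  induction n using Nat.strong_induction_on generalizing Q with
  | _ n ih =>
    rcases Nat.eq_zero_or_pos n with rfl | hn
    · have := hQ.length_eq
      have : Q = [] := List.length_eq_zero_iff.1 (by omega)
      subst this
      exact ⟨hQ, fun α δ _ a b _ _ _ => by omega⟩
    obtain ⟨s, m, P, Y, rfl, hP, hY, rfl, hF⟩ := hQ.exists_firstComponent hn
    rw [hF]
    obtain ⟨hY', ihY⟩ := ih m (by omega) hY
    refine ⟨hP.lmap.elevate_append hY', fun α δ h a b hb hba han => ?_⟩
    rcases le_or_gt a (s + 1) with has | has
    · obtain ⟨a, rfl⟩ : ∃ a', a = a' + 1 := ⟨a - 1, by omega⟩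
      rw [precedes_elevate_append_left hP.lmap (by omega) (by omega) (by omega),
        ((h.left hP (by omega)).lmap (by omega)).precedes_iff _ _ (by omega) (by omega) hb (by omega)]
      simp only [Nat.add_sub_cancel]
      push_cast
      omega
    rcases le_or_gt b (s + 1) with hbs | hbs
    · refine iff_of_false (not_precedes_elevate_append hP.lmap has hbs) ?_
      have h1 := not_precedes_elevate_append (Y := Y) hP (show s + 1 < s + 2 by omega)
        (show s + 1 ≤ s + 1 by omega)
      rw [h.precedes_iff _ _ (by omega) (by omega) (by omega) (by omega)] at h1
      have h2 := (le_of_slowGrowth h.down_step (show 1 ≤ s + 1 by omega)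
        (show s + 1 ≤ a - 1 by omega) (by omega)).2
      have h3 := (le_of_slowGrowth h.up_step (show 1 ≤ b + 1 by omega)
        (show b + 1 ≤ s + 2 by omega) (by omega)).2
      push_cast [Nat.cast_sub (show 1 ≤ a by omega)] at h2 h3
      omega
    · obtain ⟨a, rfl⟩ : ∃ a', a = s + 1 + a' := ⟨a - (s + 1), by omega⟩
      obtain ⟨b, rfl⟩ : ∃ b', b = s + 1 + b' := ⟨b - (s + 1), by omega⟩
      rw [precedes_elevate_append_right hP.lmap (by omega),
        ihY _ _ (h.right hP hY (by omega)) a b (by omega) (by omega) (by omega)]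
      rw [show s + 1 + a - 1 = s + 1 + (a - 1) by omega, ← add_assoc (s + 1) b 1]
      push_cast
      omega

/-- The height of `p` after `x` steps. -/
def pathHeight (p : List Bool) (x : ℕ) : ℤ := stepCount true p x - stepCount false p x

theorem pathHeight_eq {p : List Bool} {x : ℕ} (hx : x ≤ p.length) :
    pathHeight p x = 2 * stepCount true p x - x := by
  have := stepCount_true_add_false p x
  unfold pathHeight
  omega

theorem eq_of_pathHeight_eq {p q : List Bool} (hl : p.length = q.length)
    (h : ∀ x, pathHeight p x = pathHeight q x) : p = q := by
  have hs : ∀ x, stepCount true p x = stepCount true q x := by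
    intro x
    have h1 := stepCount_true_add_false p x
    have h2 := stepCount_true_add_false q x
    have h3 := h x
    unfold pathHeight at h3
    omega
  refine List.ext_getElem hl fun x hx hx' => ?_
  have h1 := stepCount_succ true p x
  have h2 := stepCount_succ true q x
  rw [hs, hs, h2, List.getElem?_eq_getElem hx, List.getElem?_eq_getElem hx'] at h1
  generalize p[x] = b at h1 ⊢
  generalize q[x] = c at h1 ⊢
  cases b <;> cases c <;> simp at h1 <;> rfl

theorem IsDyckN.isHeight {n : ℕ} {p : List Bool} (hp : IsDyckN n p) :
    IsHeight n (pathHeight p) where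
  zero := by simp [pathHeight, stepCount_zero]
  tail x hx := by
    have hl := hp.length_eq
    rw [pathHeight, stepCount_of_length_le (by omega), stepCount_of_length_le (by omega), hp.1.1]
    simp
  nonneg x := by
    have := hp.stepCount_le x
    unfold pathHeight
    omega
  step x hx := by
    have hl := hp.length_eq
    rw [pathHeight_eq (by omega), pathHeight_eq (by omega), stepCount_succ]
    push_cast
    split_ifs <;> omega

/-- The height function of a Dyck path. -/
def IsDyckN.height {n : ℕ} {p : List Bool} (hp : IsDyckN n p) : DyckHeight n :=
  ⟨pathHeight p, hp.isHeight⟩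

theorem pathHeight_rmap {n : ℕ} {p : List Bool} (hp : IsDyckN n p) (x : ℕ) :
    pathHeight (Rmap p) x = pathHeight p (2 * n - x) := by
  have key : ∀ v, stepCount v (Rmap p) x + stepCount (!v) p (2 * n - x) = p.count (!v) := by
    intro v
    conv_rhs => rw [← List.take_append_drop (2 * n - x) p, List.count_append]
    rw [add_comm, stepCount, stepCount, Rmap, List.take_reverse, List.count_reverse, ← List.map_drop,
      List.length_map, hp.length_eq]
    congr 1
    have := List.count_map_of_injective (p.drop (2 * n - x)) (fun b => !b)
      (fun a b => by simp) (!v)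
    simpa using this
  have h1 := key true
  have h2 := key false
  have h3 := hp.1.1
  simp only [Bool.not_true, Bool.not_false] at h1 h2
  unfold pathHeight
  omega

section PeakValley

variable {n i j : ℕ} {p : List Bool}

theorem IsDyckN.isPeak_iff (hp : IsDyckN n p) (hij : i + j + 2 ≤ 2 * n) :
    IsPeak ((i : ℤ) - j) (i + j) (pathHeight p) ↔
      Precedes true p (i + 1) (j + 1) ∧ ¬ Precedes true p (i + 1) j ∧
        ¬ Precedes true p (i + 2) (j + 1) := by
  have hl := hp.length_eq
  unfold IsPeak Precedes
  rw [pathHeight_eq (by omega), pathHeight_eq (by omega), pathHeight_eq (by omega),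
    show i + 1 + (j + 1) - 1 = i + j + 1 by omega, show i + 1 + j - 1 = i + j by omega,
    show i + 2 + (j + 1) - 1 = i + j + 1 + 1 by omega, show i + j + 2 = i + j + 1 + 1 from rfl]
  have h1 := stepCount_succ true p (i + j)
  have h2 := stepCount_succ true p (i + j + 1)
  push_cast
  split_ifs at h1 h2 <;> omega

theorem IsDyckN.isValley_iff (hp : IsDyckN n p) (hi : 1 ≤ i) (hij : i + j + 2 ≤ 2 * n) :
    IsValley ((i : ℤ) - j) (i + j) (pathHeight p) ↔
      Precedes true p i (j + 1) ∧ ¬ Precedes true p (i + 1) (j + 1) ∧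
        Precedes true p (i + 1) (j + 2) := by
  have hl := hp.length_eq
  unfold IsValley Precedes
  rw [pathHeight_eq (by omega), pathHeight_eq (by omega), pathHeight_eq (by omega),
    show i + 1 + (j + 1) - 1 = i + j + 1 by omega, show i + (j + 1) - 1 = i + j by omega,
    show i + 1 + (j + 2) - 1 = i + j + 1 + 1 by omega, show i + j + 2 = i + j + 1 + 1 from rfl]
  have h1 := stepCount_succ true p (i + j)
  have h2 := stepCount_succ true p (i + j + 1)
  push_cast
  split_ifs at h1 h2 <;> omega

theorem IsDyckN.exists_of_pathHeight_eq (hp : IsDyckN n p) {r : ℤ} {x : ℕ} (hr : 1 ≤ r)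
    (h1 : pathHeight p x = r) (h2 : pathHeight p (x + 2) = r) :
    ∃ i j : ℕ, x = i + j ∧ r = (i : ℤ) - j ∧ i + j + 2 ≤ 2 * n := by
  have hl := hp.length_eq
  have hx : x + 2 ≤ 2 * n := by
    by_contra hx
    rw [hp.isHeight.tail (x + 2) (by omega)] at h2
    omega
  have h3 := stepCount_le_self true p x
  rw [pathHeight_eq (by omega)] at h1
  exact ⟨stepCount true p x, x - stepCount true p x, by omega, by omega, by omega⟩

end PeakValley

theorem IsDyckN.deriv_comp {n : ℕ} {p : List Bool} (hp : IsDyckN n p) :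
    IsDyckN n ((pathDeriv Lmap ∘ Lmap) p) :=
  hp.lmap.pathDeriv_lmap.1

theorem IsDyckN.precedes_deriv_comp_iff {n : ℕ} {p : List Bool} {α δ : ℕ → ℤ} (hp : IsDyckN n p)
    (h : HasCode n p α δ) {a b : ℕ} (hb : 1 ≤ b) (hba : b < a) (han : a ≤ n) :
    Precedes true ((pathDeriv Lmap ∘ Lmap) p) a b ↔ α (a - 1) + 1 ≤ δ (b + 1) := by
  rw [Function.comp_apply, hp.lmap.pathDeriv_lmap.2 _ _ (h.lmap (by omega)) a b hb hba han]
  push_cast [Nat.cast_sub (show 1 ≤ a by omega)]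
  omega

theorem IsDyckN.isPeak_deriv_comp_iff {n : ℕ} {p : List Bool} (hp : IsDyckN n p) {r : ℤ} {x : ℕ}
    (hr : 1 ≤ r) : IsPeak r x (pathHeight ((pathDeriv Lmap ∘ Lmap) p)) ↔
      IsValley r x (pathHeight p) := by
  by_cases hex : ∃ i j : ℕ, x = i + j ∧ r = (i : ℤ) - j ∧ i + j + 2 ≤ 2 * n
  swap
  · exact iff_of_false (fun h => hex (hp.deriv_comp.exists_of_pathHeight_eq hr h.1 h.2.2))
      (fun h => hex (hp.exists_of_pathHeight_eq hr h.1 h.2.2))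
  obtain ⟨i, j, rfl, rfl, hij⟩ := hex
  rw [hp.deriv_comp.isPeak_iff hij, hp.isValley_iff (by omega) hij]
  have large : ∀ {q : List Bool} {a b : ℕ}, IsDyckN n q → n < a → ¬ Precedes true q a b := by
    intro q a b hq ha h
    unfold Precedes at h
    have h1 := stepCount_le_count true q (a + b - 1)
    have h2 := hq.2
    omega
  rcases le_or_gt (i + 1) n with hin | hin
  swap
  · exact iff_of_false (fun h => large hp.deriv_comp hin h.1) (fun h => large hp hin h.2.2)
  have h := hp.hasCode
  set α := singleCount true p
  set δ := singleCount false p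
  have h1 : ¬ Precedes true ((pathDeriv Lmap ∘ Lmap) p) (i + 1) j ↔ δ (j + 1) ≤ α i := by
    rcases Nat.eq_zero_or_pos j with rfl | hj
    · have h2 := stepCount_le_self true ((pathDeriv Lmap ∘ Lmap) p) i
      have h3 := (le_of_slowGrowth h.up_step le_rfl (show 1 ≤ i by omega) (by omega)).1
      rw [h.up_one] at h3
      rw [zero_add, h.down_one]
      refine iff_of_true ?_ h3
      unfold Precedes
      rw [show i + 1 + 0 - 1 = i by omega]
      omega
    · rw [hp.precedes_deriv_comp_iff h hj (by omega) hin, Nat.add_sub_cancel]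
      omega
  have h2 : ¬ Precedes true ((pathDeriv Lmap ∘ Lmap) p) (i + 2) (j + 1) ↔ δ (j + 2) ≤ α (i + 1) := by
    rcases lt_or_ge n (i + 2) with hn | hn
    · refine iff_of_true (large hp.deriv_comp hn) ?_
      obtain rfl : n = i + 1 := by omega
      rw [h.last]
      exact (le_of_slowGrowth h.down_step (by omega) (by omega) le_rfl).1
    · rw [hp.precedes_deriv_comp_iff h (by omega) (by omega) hn, show i + 2 - 1 = i + 1 by omega,
        show j + 1 + 1 = j + 2 from rfl]
      omega
  rw [h1, h2, hp.precedes_deriv_comp_iff h (by omega) (by omega) hin, Nat.add_sub_cancel,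
    h.precedes_iff _ _ (by omega) (by omega) (by omega) (by omega),
    h.precedes_iff _ _ (by omega) (by omega) (by omega) (by omega),
    h.precedes_iff _ _ (by omega) (by omega) (by omega) (by omega)]
  have h3 := h.up_step i (by omega) (by omega)
  have h4 := h.down_step (j + 1) (by omega) (by omega)
  simp only [show j + 1 + 1 = j + 2 from rfl] at h4 ⊢
  omega

theorem IsDyckN.height_iterate {n : ℕ} {p : List Bool} (hp : IsDyckN n p) (k : ℕ) :
    ∃ h : IsDyckN n ((pathDeriv Lmap ∘ Lmap)^[k] p),
      h.height = (coxeterProd (heightToggle n) n ^ k) hp.height := by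
  induction k with
  | zero => exact ⟨hp, rfl⟩
  | succ k ih =>
    obtain ⟨h, ih⟩ := ih
    rw [Function.iterate_succ_apply', pow_succ', Equiv.Perm.mul_apply, ← ih]
    exact ⟨h.deriv_comp, eq_coxeterProd_of_isPeak_iff _ _ fun r x hr => h.isPeak_deriv_comp_iff hr⟩

/-- For every `n ≥ 1`, the composition `L' ∘ L` applied `n` times to any Dyck `n`-path
equals the reversal of that path: `(L' ∘ L)^n = R` on Dyck `n`-paths. -/
theorem iterate_lkDeriv_comp_lk_eq_reverse (n : ℕ) (hn : 1 ≤ n) (p : List Bool)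
    (hp : IsDyckN n p) :
    (pathDeriv Lmap ∘ Lmap)^[n] p = Rmap p := by
  obtain ⟨h, hh⟩ := hp.height_iterate n
  rw [coxeterProd_heightToggle_pow hn] at hh
  refine eq_of_pathHeight_eq ?_ fun x => ?_
  · rw [h.length_eq, Rmap, List.length_reverse, List.length_map, hp.length_eq]
  · rw [pathHeight_rmap hp]
    exact congrFun (congrArg Subtype.val hh) x
end

section
/- The partial-sum ascent-descent code gives a bijection between Dyck n-paths and pairs of integer sequences ((A_i)_{i=1}^r,(D_i)_{i=1}^r) satisfying: 0 ≤ r ≤ n-1, 1 ≤ A_1 < A_2 < ... < A_r ≤ n-1, 1 ≤ D_1 < D_2 < ... < D_r ≤ n-1, and A_i ≥ D_i for 1 ≤ i ≤ r. -/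
/-- Truncated partial sums `A_1 < … < A_r` of the ascent lengths: `A_i` is the number of
upsteps up to (and including) the `i`-th peak, the last peak being dropped. -/
def ascPartial (p : List Bool) : List ℕ :=
  ((adjPositions true false p).map (fun j => (p.take (j+1)).count true)).dropLast

/-- Truncated partial sums `D_1 < … < D_r` of the descent lengths: `D_i` is the number of
downsteps up to (and including) the `i`-th valley. -/
def descPartial (p : List Bool) : List ℕ :=
  (adjPositions false true p).map (fun j => (p.take (j+1)).count false)

/-- The (truncated) partial-sum ascent-descent code `(A, D)` of a Dyck path. -/
def adCode (p : List Bool) : List ℕ × List ℕ := (ascPartial p, descPartial p)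

/-- The conditions (2) for a valid partial-sum ascent-descent code of size `n`:
`0 ≤ r ≤ n - 1`, `1 ≤ A_1 < … < A_r ≤ n - 1`, `1 ≤ D_1 < … < D_r ≤ n - 1`, and
`A_i ≥ D_i` for `1 ≤ i ≤ r`. -/
def ValidCode (n : ℕ) (A D : List ℕ) : Prop :=
  A.length = D.length ∧ A.length ≤ n - 1 ∧
  A.Chain' (· < ·) ∧ D.Chain' (· < ·) ∧
  (∀ x ∈ A, 1 ≤ x ∧ x ≤ n - 1) ∧ (∀ x ∈ D, 1 ≤ x ∧ x ≤ n - 1) ∧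
  (∀ i, i < A.length → D.getD i 0 ≤ A.getD i 0)

/-- The list of values of the counter of `s`-steps at each maximal run of `s` that is followed by
another step, for a path `p` read after a step `b`, where `c` is the initial counter. -/
def runCounts (s : Bool) : Bool → ℕ → List Bool → List ℕ
  | _, _, [] => []
  | b, c, x :: p =>
    if x = s then runCounts s x (c + 1) p
    else if b = s then c :: runCounts s x c p else runCounts s x c p

/-- `p` leads from the point with `a` upsteps and `d` downsteps to the point with `n` of each,
never going below the axis. -/
inductive DyckFrom (n : ℕ) : ℕ → ℕ → List Bool → Prop
  | nil : DyckFrom n n n []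
  | up {a d : ℕ} {p : List Bool} : DyckFrom n (a + 1) d p → DyckFrom n a d (true :: p)
  | down {a d : ℕ} {p : List Bool} :
      d < a → DyckFrom n a (d + 1) p → DyckFrom n a d (false :: p)

/-- The recursive form of the conditions on a code, with lower bounds `a` and `d` for the
first entries. -/
inductive Ladder (n : ℕ) : ℕ → ℕ → List ℕ → List ℕ → Prop
  | nil {a d : ℕ} : a ≤ n → d < n → Ladder n a d [] []
  | cons {a d x y : ℕ} {A D : List ℕ} :
      a ≤ x → d < y → y ≤ x → Ladder n (x + 1) y A D → Ladder n a d (x :: A) (y :: D)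

lemma adjPositions_cons (a b x : Bool) (p : List Bool) :
    adjPositions a b (x :: p) =
      (if x = a ∧ p[0]? = some b then [0] else []) ++ (adjPositions a b p).map Nat.succ := by
  unfold adjPositions
  rw [List.length_cons, List.range_succ_eq_map, List.filter_cons, List.filter_map]
  have h : ((fun j => (x :: p)[j]? == some a && (x :: p)[j + 1]? == some b) ∘ Nat.succ) =
      fun j => p[j]? == some a && p[j + 1]? == some b := by
    funext j; simp
  rw [h]
  by_cases h1 : x = a <;> by_cases h2 : p[0]? = some b <;> simp [h1, h2]

lemma map_adjPositions_cons (s b : Bool) (c : ℕ) (p : List Bool) :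
    (adjPositions s (!s) (b :: p)).map (fun j => c + ((b :: p).take (j + 1)).count s) =
      runCounts s b (c + if b = s then 1 else 0) p := by
  induction p generalizing b c with
  | nil => simp [adjPositions, runCounts]
  | cons x p ih =>
    have ih' := ih x (c + if b = s then 1 else 0)
    rw [adjPositions_cons, List.map_append, List.map_map]
    have h : ((fun j => c + ((b :: x :: p).take (j + 1)).count s) ∘ Nat.succ) =
        fun j => (c + if b = s then 1 else 0) + ((x :: p).take (j + 1)).count s := by
      funext j
      simp only [Function.comp, Nat.succ_eq_add_one, List.take_succ_cons, List.count_cons]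
      simp only [beq_iff_eq]
      omega
    rw [h, ih']
    cases s <;> cases b <;> cases x <;> simp [runCounts]

lemma adCode_true_cons (p : List Bool) :
    adCode (true :: p) = ((runCounts true true 1 p).dropLast, runCounts false true 0 p) := by
  have h1 := map_adjPositions_cons true true 0 p
  have h2 := map_adjPositions_cons false true 0 p
  simp only [zero_add, Bool.not_true, Bool.not_false, if_true, Bool.true_eq_false, if_false]
    at h1 h2
  simp only [adCode, ascPartial, descPartial, h1, h2]

lemma adCode_nil : adCode [] = ([], []) := rfl

lemma le_of_mem_runCounts {s b : Bool} {c x : ℕ} {p : List Bool}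
    (h : x ∈ runCounts s b c p) : c ≤ x := by
  induction p generalizing b c with
  | nil => simp [runCounts] at h
  | cons y p ih =>
    unfold runCounts at h
    split_ifs at h
    · exact (Nat.le_succ c).trans (ih h)
    · rcases List.mem_cons.1 h with rfl | h
      · exact le_rfl
      · exact ih h
    · exact ih h

lemma runCounts_succ_ne_cons (s b : Bool) (c : ℕ) (p : List Bool) (L : List ℕ) :
    runCounts s b (c + 1) p ≠ c :: L := by
  intro h
  have := le_of_mem_runCounts (h ▸ List.mem_cons_self : c ∈ runCounts s b (c + 1) p)
  omega

lemma runCounts_injective {b : Bool} {a d : ℕ} {p q : List Bool} (hl : p.length = q.length)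
    (ht : runCounts true b a p = runCounts true b a q)
    (hf : runCounts false b d p = runCounts false b d q) : p = q := by
  induction p generalizing b a d q with
  | nil => exact (List.length_eq_zero_iff.1 hl.symm).symm
  | cons x p ih =>
    cases q with
    | nil => simp at hl
    | cons y q =>
      have hl' : p.length = q.length := by simpa using hl
      cases b <;> cases x <;> cases y <;> simp [runCounts] at ht hf
      all_goals first
        | rw [ih hl' ht hf]
        | exact absurd hf (runCounts_succ_ne_cons _ _ _ _ _)
        | exact absurd hf.symm (runCounts_succ_ne_cons _ _ _ _ _)
        | exact absurd ht (runCounts_succ_ne_cons _ _ _ _ _)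
        | exact absurd ht.symm (runCounts_succ_ne_cons _ _ _ _ _)

lemma runCounts_replicate_append_self (s : Bool) (c k : ℕ) (p : List Bool) :
    runCounts s s c (List.replicate k s ++ p) = runCounts s s (c + k) p := by
  induction k generalizing c with
  | zero => rfl
  | succ k ih =>
    rw [List.replicate_succ, List.cons_append, runCounts, if_pos rfl, ih, Nat.add_right_comm,
      Nat.add_assoc]

lemma runCounts_replicate_append_of_ne {s b : Bool} (h : b ≠ s) (c k : ℕ) (p : List Bool) :
    runCounts s b c (List.replicate k b ++ p) = runCounts s b c p := by
  induction k with
  | zero => rfl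
  | succ k ih => rw [List.replicate_succ, List.cons_append, runCounts, if_neg h, if_neg h, ih]

lemma DyckFrom.replicate_true_append {n a d k : ℕ} {p : List Bool}
    (h : DyckFrom n (a + k) d p) : DyckFrom n a d (List.replicate k true ++ p) := by
  induction k generalizing a with
  | zero => exact h
  | succ k ih => exact .up (ih (by rwa [Nat.add_right_comm]))

lemma DyckFrom.replicate_false_append {n a d k : ℕ} {p : List Bool} (hk : d + k ≤ a)
    (h : DyckFrom n a (d + k) p) : DyckFrom n a d (List.replicate k false ++ p) := by
  induction k generalizing d with
  | zero => exact h
  | succ k ih =>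
    exact .down (by omega) (ih (by omega) (by rwa [Nat.add_right_comm]))

lemma dyckFrom_iff {n a d : ℕ} (hda : d ≤ a) (p : List Bool) :
    DyckFrom n a d p ↔ a + p.count true = n ∧ d + p.count false = n ∧
      ∀ q : List Bool, q <+: p → d + q.count false ≤ a + q.count true := by
  constructor
  · intro h
    induction h with
    | nil => simp
    | up h ih =>
      obtain ⟨h1, h2, h3⟩ := ih (by omega)
      refine ⟨by simp; omega, by simpa using h2, fun q hq => ?_⟩
      rcases List.prefix_cons_iff.1 hq with rfl | ⟨t, rfl, ht⟩
      · simpa using hda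
      · have := h3 t ht
        simp
        omega
    | down hlt h ih =>
      obtain ⟨h1, h2, h3⟩ := ih (by omega)
      refine ⟨by simpa using h1, by simp; omega, fun q hq => ?_⟩
      rcases List.prefix_cons_iff.1 hq with rfl | ⟨t, rfl, ht⟩
      · simpa using hda
      · have := h3 t ht
        simp
        omega
  · induction p generalizing a d with
    | nil =>
      rintro ⟨h1, h2, -⟩
      simp at h1 h2
      subst h1 h2
      exact .nil
    | cons x p ih =>
      rintro ⟨h1, h2, h3⟩
      cases x
      · have h4 := h3 [false] ⟨p, rfl⟩
        simp at h1 h2 h4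
        refine .down (by omega) (ih (by omega) ⟨h1, by omega, fun q hq => ?_⟩)
        have := h3 (false :: q) (List.cons_prefix_cons.2 ⟨rfl, hq⟩)
        simp at this
        omega
      · simp at h1 h2
        refine .up (ih (by omega) ⟨by omega, h2, fun q hq => ?_⟩)
        have := h3 (true :: q) (List.cons_prefix_cons.2 ⟨rfl, hq⟩)
        simp at this
        omega

lemma isDyckN_iff_dyckFrom {n : ℕ} {p : List Bool} : IsDyckN n p ↔ DyckFrom n 0 0 p := by
  rw [dyckFrom_iff le_rfl, IsDyckN, IsDyck]
  simp only [zero_add]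
  constructor
  · rintro ⟨⟨h1, h2⟩, h3⟩
    exact ⟨h3, h1 ▸ h3, h2⟩
  · rintro ⟨h1, h2, h3⟩
    exact ⟨⟨h1.trans h2.symm, h3⟩, h1⟩

lemma isDyckN_iff {n : ℕ} {p : List Bool} :
    IsDyckN n p ↔ (n = 0 ∧ p = []) ∨ ∃ q, p = true :: q ∧ DyckFrom n 1 0 q := by
  rw [isDyckN_iff_dyckFrom]
  constructor
  · intro h
    cases h with
    | nil => exact .inl ⟨rfl, rfl⟩
    | up h => exact .inr ⟨_, rfl, h⟩
    | down h _ => omega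
  · rintro (⟨rfl, rfl⟩ | ⟨q, rfl, h⟩)
    · exact .nil
    · exact .up h

lemma Ladder.mono {n a a' d : ℕ} {A D : List ℕ} (ha : a' ≤ a) (h : Ladder n a d A D) :
    Ladder n a' d A D := by
  cases h with
  | nil h1 h2 => exact .nil (ha.trans h1) h2
  | cons h1 h2 h3 h4 => exact .cons (ha.trans h1) h2 h3 h4

/-- The codes read off after an upstep (first component) and after a downstep (second). -/
lemma DyckFrom.ladder {n a d : ℕ} {p : List Bool} (h : DyckFrom n a d p) :
    (d < a → ∃ A, runCounts true true a p = A ++ [n] ∧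
      Ladder n a d A (runCounts false true d p)) ∧
    (d ≤ a → (a = n ∧ runCounts true false a p = [] ∧ runCounts false false d p = []) ∨
      ∃ A y D, runCounts true false a p = A ++ [n] ∧ runCounts false false d p = y :: D ∧
        d ≤ y ∧ y ≤ a ∧ Ladder n (a + 1) y A D) := by
  induction h with
  | nil => exact ⟨fun h => absurd h (lt_irrefl _), fun _ => .inl ⟨rfl, rfl, rfl⟩⟩
  | @up a d p h ih =>
    refine ⟨fun hlt => ?_, fun hle => ?_⟩
    · obtain ⟨A, h1, h2⟩ := ih.1 (by omega)
      exact ⟨A, by simpa [runCounts] using h1, by simpa [runCounts] using h2.mono (Nat.le_succ a)⟩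
    · obtain ⟨A, h1, h2⟩ := ih.1 (by omega)
      exact .inr ⟨A, d, _, by simpa [runCounts] using h1, by simp [runCounts], le_rfl, hle, h2⟩
  | @down a d p hlt h ih =>
    have hV := ih.2 hlt
    refine ⟨fun _ => ?_, fun _ => ?_⟩
    · rcases hV with ⟨rfl, h1, h2⟩ | ⟨A, y, D, h1, h2, h3, h4, h5⟩
      · exact ⟨[], by simp [runCounts, h1], by simpa [runCounts, h2] using .nil le_rfl hlt⟩
      · exact ⟨a :: A, by simp [runCounts, h1],
          by simpa [runCounts, h2] using .cons le_rfl h3 h4 h5⟩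
    · rcases hV with ⟨h0, h1, h2⟩ | ⟨A, y, D, h1, h2, h3, h4, h5⟩
      · exact .inl ⟨h0, by simp [runCounts, h1], by simp [runCounts, h2]⟩
      · exact .inr ⟨A, y, D, by simp [runCounts, h1], by simp [runCounts, h2], by omega, h4, h5⟩

lemma Ladder.exists_dyckFrom {n a d : ℕ} {A D : List ℕ} (h : Ladder n a d A D) (hda : d < a) :
    ∃ p, DyckFrom n a d p ∧ runCounts true true a p = A ++ [n] ∧
      runCounts false true d p = D := by
  induction h with
  | @nil a d ha hd =>
    obtain ⟨k, rfl⟩ := Nat.exists_eq_add_of_le ha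
    obtain ⟨m, hm⟩ := Nat.exists_eq_add_of_le (Nat.succ_le_of_lt hd)
    refine ⟨List.replicate k true ++ false :: (List.replicate m false ++ []), ?_, ?_, ?_⟩
    · refine .replicate_true_append (.down hd (.replicate_false_append hm.ge ?_))
      rw [← Nat.succ_eq_add_one, ← hm]
      exact .nil
    · rw [runCounts_replicate_append_self]
      simp only [runCounts, Bool.false_eq_true, if_false, if_true]
      rw [runCounts_replicate_append_of_ne (by decide)]
      rfl
    · rw [runCounts_replicate_append_of_ne (by decide)]
      simp only [runCounts, if_true]
      rw [runCounts_replicate_append_self]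
      rfl
  | @cons a d x y A D ha hd hyx h ih =>
    obtain ⟨p, hp, h1, h2⟩ := ih (by omega)
    obtain ⟨k, rfl⟩ := Nat.exists_eq_add_of_le ha
    obtain ⟨m, rfl⟩ := Nat.exists_eq_add_of_le (Nat.succ_le_of_lt hd)
    refine ⟨List.replicate k true ++ false :: (List.replicate m false ++ true :: p), ?_, ?_, ?_⟩
    · exact .replicate_true_append (.down (by omega) (.replicate_false_append hyx (.up hp)))
    · rw [runCounts_replicate_append_self]
      simp only [runCounts, Bool.false_eq_true, if_false, if_true]
      rw [runCounts_replicate_append_of_ne (by decide)]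
      simp [runCounts, h1]
    · rw [runCounts_replicate_append_of_ne (by decide)]
      simp only [runCounts, if_true]
      rw [runCounts_replicate_append_self]
      simpa [runCounts] using h2

lemma Ladder.bounds {n a d : ℕ} {A D : List ℕ} (h : Ladder n a d A D) :
    A.length + a ≤ n ∧ d < n := by
  induction h with
  | nil h1 h2 => simpa using ⟨h1, h2⟩
  | cons h1 h2 h3 h4 ih => simp only [List.length_cons]; omega

lemma ladder_iff {n a d : ℕ} (ha : a ≤ n) (hd : d < n) (A D : List ℕ) :
    Ladder n a d A D ↔ A.length = D.length ∧ A.IsChain (· < ·) ∧ D.IsChain (· < ·) ∧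
      (∀ x ∈ A, a ≤ x ∧ x < n) ∧ (∀ y ∈ D, d < y ∧ y < n) ∧
      ∀ i, i < A.length → D.getD i 0 ≤ A.getD i 0 := by
  simp only [List.isChain_iff_pairwise]
  constructor
  · intro h
    induction h with
    | nil => simp
    | @cons a d x y A D hax hdy hyx h ih =>
      have hn : x + 1 ≤ n ∧ y < n := by have := h.bounds; omega
      obtain ⟨h1, h2, h3, h4, h5, h6⟩ := ih hn.1 hn.2
      refine ⟨by simp [h1], List.pairwise_cons.2 ⟨fun z hz => (h4 z hz).1, h2⟩,
        List.pairwise_cons.2 ⟨fun z hz => (h5 z hz).1, h3⟩, ?_, ?_, ?_⟩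
      · simp only [List.mem_cons, forall_eq_or_imp]
        exact ⟨⟨hax, hn.1⟩, fun z hz => by have := h4 z hz; omega⟩
      · simp only [List.mem_cons, forall_eq_or_imp]
        exact ⟨⟨hdy, hn.2⟩, fun z hz => by have := h5 z hz; omega⟩
      · rintro (_ | i) hi
        · simpa using hyx
        · simpa using h6 i (by simpa using hi)
  · induction A generalizing a d D with
    | nil =>
      rintro ⟨h, -⟩
      rw [List.length_eq_zero_iff.1 h.symm]
      exact .nil ha hd
    | cons x A ih =>
      rintro ⟨h1, h2, h3, h4, h5, h6⟩
      cases D with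
      | nil => simp at h1
      | cons y D =>
        rw [List.pairwise_cons] at h2 h3
        simp only [List.mem_cons, forall_eq_or_imp] at h4 h5
        refine .cons h4.1.1 h5.1.1 (by simpa using h6 0 (by simp))
          (ih h4.1.2 h5.1.2 D ⟨by simpa using h1, h2.2, h3.2,
            fun z hz => ⟨h2.1 z hz, (h4.2 z hz).2⟩, fun z hz => ⟨h3.1 z hz, (h5.2 z hz).2⟩,
            fun i hi => by simpa using h6 (i + 1) (by simpa using hi)⟩)

lemma validCode_iff_ladder {n : ℕ} (hn : 0 < n) (A D : List ℕ) :
    ValidCode n A D ↔ Ladder n 1 0 A D := by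
  have hlt : ∀ x, x ≤ n - 1 ↔ x < n := fun x => by omega
  constructor
  · rintro ⟨h1, -, h2, h3, h4, h5, h6⟩
    simp only [hlt] at h4 h5
    exact (ladder_iff hn hn A D).2 ⟨h1, h2, h3, h4, h5, h6⟩
  · intro h
    obtain ⟨h1, h2, h3, h4, h5, h6⟩ := (ladder_iff hn hn A D).1 h
    refine ⟨h1, Nat.le_sub_of_add_le h.bounds.1, h2, h3, ?_, ?_, h6⟩ <;> simp only [hlt]
    exacts [h4, h5]

lemma DyckFrom.pos {n a d : ℕ} {p : List Bool} (h : DyckFrom n (a + 1) d p) : 0 < n := by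
  generalize ha : a + 1 = b at h
  induction h generalizing a with
  | nil => omega
  | @up b d p h ih => exact ih rfl
  | down _ _ ih => exact ih ha

lemma DyckFrom.length_add {n a d : ℕ} {p : List Bool} (h : DyckFrom n a d p) :
    p.length + a + d = 2 * n := by
  induction h with
  | nil => simp; omega
  | up h ih => simp; omega
  | down _ h ih => simp; omega

lemma validCode_zero_iff {A D : List ℕ} : ValidCode 0 A D ↔ A = [] ∧ D = [] := by
  constructor
  · rintro ⟨h1, h2, -⟩
    exact ⟨List.length_eq_zero_iff.1 (by omega), List.length_eq_zero_iff.1 (by omega)⟩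
  · rintro ⟨rfl, rfl⟩
    exact ⟨rfl, le_rfl, .nil, .nil, by simp, by simp, by simp⟩

/-- The partial-sum ascent-descent code is a bijection from Dyck `n`-paths onto the pairs
of integer sequences `(A, D)` satisfying `0 ≤ r ≤ n - 1`, `1 ≤ A_1 < … < A_r ≤ n - 1`,
`1 ≤ D_1 < … < D_r ≤ n - 1`, and `A_i ≥ D_i` for `1 ≤ i ≤ r`. -/
theorem adCode_bijOn (n : ℕ) :
    Set.BijOn adCode {p : List Bool | IsDyckN n p}
      {c : List ℕ × List ℕ | ValidCode n c.1 c.2} := by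
  refine ⟨fun p hp => ?_, fun p hp q hq hpq => ?_, fun ⟨A, D⟩ hc => ?_⟩
  · rcases isDyckN_iff.1 hp with ⟨rfl, rfl⟩ | ⟨p, rfl, dp⟩
    · exact validCode_zero_iff.2 ⟨rfl, rfl⟩
    · obtain ⟨A, h1, h2⟩ := dp.ladder.1 zero_lt_one
      simpa [adCode_true_cons, h1] using (validCode_iff_ladder dp.pos _ _).2 h2
  · rcases isDyckN_iff.1 hp with ⟨rfl, rfl⟩ | ⟨p, rfl, dp⟩ <;>
      rcases isDyckN_iff.1 hq with ⟨h0, rfl⟩ | ⟨q, rfl, dq⟩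
    · rfl
    · exact absurd dq.pos (lt_irrefl 0)
    · exact absurd dp.pos (by omega)
    · obtain ⟨A, h1, -⟩ := dp.ladder.1 zero_lt_one
      obtain ⟨B, h2, -⟩ := dq.ladder.1 zero_lt_one
      simp only [adCode_true_cons, h1, h2, List.dropLast_concat, Prod.mk.injEq] at hpq
      rw [runCounts_injective (by have := dp.length_add; have := dq.length_add; omega)
        (by rw [h1, h2, hpq.1]) hpq.2]
  · rcases Nat.eq_zero_or_pos n with rfl | hn
    · obtain ⟨rfl, rfl⟩ := validCode_zero_iff.1 hc
      exact ⟨[], isDyckN_iff.2 (.inl ⟨rfl, rfl⟩), adCode_nil⟩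
    · obtain ⟨p, hp, h1, h2⟩ := ((validCode_iff_ladder hn _ _).1 hc).exists_dyckFrom zero_lt_one
      exact ⟨true :: p, isDyckN_iff.2 (.inr ⟨p, rfl, hp⟩), by simp [adCode_true_cons, h1, h2]⟩
end
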